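/- arXiv:2408.05887 — 9 statements merged into one kernel-verified Lean document; each statement's English description precedes it below -/
import Mathlib

section
/- Let K ≥ 2, α ∈ (0,1), ψ ∈ ℝ, let Σ be a K×K positive definite matrix with λ = 1_K^TΣ^{-1}1_K, and let (Y_n)_{n≥1} be ℝ^K-valued random vectors such that √n(Y_n − ψ1_K) converges in distribution to N(0, σ²Σ) for some σ > 0. Define m(y) = 1_K^TΣ^{-1}y/λ, S(y)² = (1/(λ(K−1)))·(y − m(y)1_K)^TΣ^{-1}(y − m(y)1_K), and CI_GS(y) = [m(y) − t_{K−1,1−α/2}S(y), m(y) + t_{K−1,1−α/2}S(y)]. Then: (i) for every δ ∈ ℝ, lim_n P(ψ + n^{−1/2}δ ∈ CI_GS(Y_n)) exists, equals 1−α at δ = 0, and is at most 1−α for δ ≠ 0; (ii) for every homogeneous pair (L,U) that is asymptotically unbiased at level 1−α for ψ with respect to (Y_n), and every δ ≠ 0, limsup_n P(L(Y_n) ≤ ψ + n^{−1/2}δ ≤ U(Y_n)) ≥ lim_n P(ψ + n^{−1/2}δ ∈ CI_GS(Y_n)). -/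
open MeasureTheory ProbabilityTheory Matrix Filter Topology

noncomputable section

/-- The standard Gaussian measure on `Fin K → ℝ` (K i.i.d. standard normal coordinates). -/
def stdGaussianPi (K : ℕ) : Measure (Fin K → ℝ) :=
  Measure.pi fun _ => gaussianReal 0 1

/-- `IsGaussianVec μ m C` means that `μ` is the Gaussian measure `N(m, C)` on `ℝ^K`,
realized as the law of `m + A ξ` where `A Aᵀ = C` and `ξ` is standard Gaussian. -/
def IsGaussianVec {K : ℕ} (μ : Measure (Fin K → ℝ)) (m : Fin K → ℝ)
    (C : Matrix (Fin K) (Fin K) ℝ) : Prop :=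
  ∃ A : Matrix (Fin K) (Fin K) ℝ, C = A * Aᵀ ∧
    μ = (stdGaussianPi K).map (fun ξ => m + A.mulVec ξ)

/-- The chi-squared distribution with `m` degrees of freedom: Gamma with shape `m/2`, rate `1/2`. -/
def chiSq (m : ℝ) : Measure ℝ := gammaMeasure (m / 2) (1 / 2)

/-- The Student t distribution with `df` degrees of freedom:
the law of `N / √(Q/df)` with `N` standard normal independent of `Q ~ χ²_df`. -/
def studentT (df : ℝ) : Measure ℝ :=
  ((gaussianReal 0 1).prod (chiSq df)).map fun p => p.1 / Real.sqrt (p.2 / df)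

/-- The `p`-quantile of the Student t distribution with `df` degrees of freedom. -/
def tQuantile (df p : ℝ) : ℝ :=
  sInf {x : ℝ | p ≤ (studentT df (Set.Iic x)).toReal}

/-- Convergence in distribution (weak convergence of laws) of `E`-valued random variables. -/
def TendstoInDist {Ω E : Type*} [MeasurableSpace Ω] [MeasurableSpace E] [TopologicalSpace E]
    (P : Measure Ω) (X : ℕ → Ω → E) (μ : Measure E) : Prop :=
  ∀ f : BoundedContinuousFunction E ℝ,
    Tendsto (fun n => ∫ ω, f (X n ω) ∂P) atTop (𝓝 (∫ x, f x ∂μ))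

end

/-- A pair of interval-endpoint functions is *homogeneous* if it is positively scale-equivariant,
translation-equivariant along the all-ones direction, and continuous. -/
def Homogeneous {K : ℕ} (L U : (Fin K → ℝ) → ℝ) : Prop :=
  (∀ c : ℝ, 0 < c → ∀ x : Fin K → ℝ, L (c • x) = c * L x ∧ U (c • x) = c * U x) ∧
  (∀ c : ℝ, ∀ x : Fin K → ℝ, L (x + c • 1) = L x + c ∧ U (x + c • 1) = U x + c) ∧
  Continuous L ∧ Continuous U

/-- `(L, U)` is asymptotically unbiased at level `1 - α` for `ψ` with respect to `Y`:
the coverage of `ψ` tends to a limit `≥ 1 - α`, and the coverage of every local alternative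
`ψ + δ/√n`, `δ ≠ 0`, has limsup `≤ 1 - α`. -/
def AsympUnbiased {Ω : Type*} [MeasurableSpace Ω] (P : Measure Ω) {K : ℕ}
    (Y : ℕ → Ω → Fin K → ℝ) (ψ α : ℝ) (L U : (Fin K → ℝ) → ℝ) : Prop :=
  (∃ ℓ : ℝ, 1 - α ≤ ℓ ∧
    Tendsto (fun n => (P {ω | L (Y n ω) ≤ ψ ∧ ψ ≤ U (Y n ω)}).toReal) atTop (𝓝 ℓ)) ∧
  (∀ δ : ℝ, δ ≠ 0 →
    limsup (fun n => (P {ω | L (Y n ω) ≤ ψ + δ / Real.sqrt n ∧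
      ψ + δ / Real.sqrt n ≤ U (Y n ω)}).toReal) atTop ≤ 1 - α)


noncomputable def gdens (K : ℕ) (x : EuclideanSpace ℝ (Fin K)) : ℝ :=
  ((√(2 * Real.pi))⁻¹) ^ K * Real.exp (-‖x‖ ^ 2 / 2)

lemma gdens_nonneg (K : ℕ) (x : EuclideanSpace ℝ (Fin K)) : 0 ≤ gdens K x := by
  unfold gdens; positivity

lemma gdens_cont (K : ℕ) : Continuous (gdens K) := by
  unfold gdens; fun_prop

lemma pi_gaussian_dens (K : ℕ) :
    (Measure.pi fun _ : Fin K => gaussianReal 0 1) =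
      (volume : Measure (Fin K → ℝ)).withDensity
        (fun x => ENNReal.ofReal (gdens K (WithLp.toLp 2 x))) := by
  refine Measure.pi_eq fun s hs => ?_
  rw [withDensity_apply _ (MeasurableSet.univ_pi hs), volume_pi, Measure.restrict_pi_pi]
  have h : ∀ x : Fin K → ℝ, gdens K (WithLp.toLp 2 x) = ∏ i, gaussianPDFReal 0 1 (x i) := by
    intro x
    simp only [gaussianPDFReal, gdens, Finset.prod_mul_distrib, Finset.prod_const]
    rw [← Real.exp_sum, EuclideanSpace.real_norm_sq_eq]
    simp [Finset.sum_div, neg_div]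
  have hi : ∀ i, Integrable (gaussianPDFReal 0 1) (volume.restrict (s i)) := fun i =>
    (integrable_gaussianPDFReal 0 1).restrict
  rw [← ofReal_integral_eq_lintegral_ofReal]
  · simp_rw [h]
    rw [integral_fintype_prod_eq_prod (f := fun _ => gaussianPDFReal 0 1),
      ENNReal.ofReal_prod_of_nonneg (fun i _ => integral_nonneg (gaussianPDFReal_nonneg _ _))]
    refine Finset.prod_congr rfl fun i _ => ?_
    rw [gaussianReal_apply_eq_integral _ one_ne_zero]
  · simp_rw [h]
    exact Integrable.fintype_prod (f := fun _ => gaussianPDFReal 0 1) hi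
  · exact ae_of_all _ fun x => gdens_nonneg _ _

lemma stdGaussian_dens (K : ℕ) :
    stdGaussian (EuclideanSpace ℝ (Fin K)) =
      (volume : Measure (EuclideanSpace ℝ (Fin K))).withDensity
        (fun x => ENNReal.ofReal (gdens K x)) := by
  rw [← map_pi_eq_stdGaussian, pi_gaussian_dens]
  have h := (EuclideanSpace.volume_preserving_symm_measurableEquiv_toLp (Fin K)).symm
  ext s hs
  rw [Measure.map_apply (by fun_prop) hs, withDensity_apply _ hs, withDensity_apply _ (by
    exact (WithLp.measurable_toLp 2 _) hs)]
  rw [← h.setLIntegral_comp_preimage hs (by have := gdens_cont K; fun_prop)]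
  rfl

lemma integral_stdGaussian (K : ℕ) (f : EuclideanSpace ℝ (Fin K) → ℝ) :
    ∫ x, f x ∂(stdGaussian (EuclideanSpace ℝ (Fin K))) = ∫ x, gdens K x * f x := by
  rw [stdGaussian_dens, integral_withDensity_eq_integral_toReal_smul]
  · simp [ENNReal.toReal_ofReal (gdens_nonneg K _)]
  · have := gdens_cont K; fun_prop
  · simp

open RealInnerProductSpace in
lemma integral_shift (K : ℕ) (f : EuclideanSpace ℝ (Fin K) → ℝ) (v : EuclideanSpace ℝ (Fin K)) :
    ∫ x, f (x - v) ∂(stdGaussian (EuclideanSpace ℝ (Fin K))) =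
    ∫ x, f x * Real.exp (-⟪v, x⟫ - ‖v‖ ^ 2 / 2) ∂(stdGaussian (EuclideanSpace ℝ (Fin K))) := by
  rw [integral_stdGaussian, integral_stdGaussian,
    ← integral_add_right_eq_self (fun x => gdens K x * f (x - v)) v]
  congr 1; ext x
  simp only [add_sub_cancel_right, gdens]
  have : Real.exp (-‖x + v‖ ^ 2 / 2) = Real.exp (-‖x‖ ^ 2 / 2) *
      Real.exp (-⟪v, x⟫ - ‖v‖ ^ 2 / 2) := by
    rw [← Real.exp_add]; congr 1
    rw [norm_add_sq_real, real_inner_comm]; ring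
  rw [this]; ring

lemma integral_hom_polar (K : ℕ) [Nontrivial (EuclideanSpace ℝ (Fin K))]
    (k : EuclideanSpace ℝ (Fin K) → ℝ) (hk : ∀ c : ℝ, 0 < c → ∀ x, k (c • x) = k x) (a : ℝ → ℝ) :
    ∫ x, k x * a ‖x‖ ∂(stdGaussian (EuclideanSpace ℝ (Fin K))) =
    (∫ u : Metric.sphere (0 : EuclideanSpace ℝ (Fin K)) 1, k u ∂(volume.toSphere)) *
     ∫ r : Set.Ioi (0 : ℝ), ((√(2 * Real.pi))⁻¹) ^ K * Real.exp (-r.1 ^ 2 / 2) * a r.1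
      ∂(Measure.volumeIoiPow (Module.finrank ℝ (EuclideanSpace ℝ (Fin K)) - 1)) := by
  rw [integral_stdGaussian]
  set E := EuclideanSpace ℝ (Fin K)
  rw [← integral_prod_mul, ← (Measure.measurePreserving_homeomorphUnitSphereProd
    (volume : Measure E)).integral_comp (Homeomorph.measurableEmbedding _)]
  rw [← restrict_compl_singleton (μ := (volume : Measure E)) 0, ← integral_subtype_comap
    (measurableSet_singleton _).compl]
  rw [restrict_compl_singleton]
  congr 1; ext x
  have hx : 0 < ‖(x : E)‖ := norm_pos_iff.2 x.2
  simp only [homeomorphUnitSphereProd_apply_snd_coe, homeomorphUnitSphereProd_apply_fst_coe]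
  rw [hk _ (inv_pos.2 hx)]
  simp only [gdens]; ring

lemma integral_hom_indep (K : ℕ) [Nontrivial (EuclideanSpace ℝ (Fin K))]
    (k : EuclideanSpace ℝ (Fin K) → ℝ) (hk : ∀ c : ℝ, 0 < c → ∀ x, k (c • x) = k x) (a : ℝ → ℝ) :
    ∫ x, k x * a ‖x‖ ∂(stdGaussian (EuclideanSpace ℝ (Fin K))) =
    (∫ x, k x ∂(stdGaussian (EuclideanSpace ℝ (Fin K)))) *
      ∫ x, a ‖x‖ ∂(stdGaussian (EuclideanSpace ℝ (Fin K))) := by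
  have h1 := integral_hom_polar K k hk a
  have h2 := integral_hom_polar K k hk (fun _ => 1)
  have h3 := integral_hom_polar K (fun _ => 1) (by simp) a
  have h4 := integral_hom_polar K (fun _ => 1) (by simp) (fun _ => 1)
  simp only [mul_one, one_mul] at h1 h2 h3 h4
  have h5 : ∫ x, (1:ℝ) ∂(stdGaussian (EuclideanSpace ℝ (Fin K))) = 1 := by simp
  rw [h5] at h4
  rw [h1, h2, h3]
  linear_combination (∫ u : Metric.sphere (0 : EuclideanSpace ℝ (Fin K)) 1, k u ∂(volume.toSphere)) *
    (∫ r : Set.Ioi (0 : ℝ), ((√(2 * Real.pi))⁻¹) ^ K * Real.exp (-r.1 ^ 2 / 2) * a r.1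
      ∂(Measure.volumeIoiPow (Module.finrank ℝ (EuclideanSpace ℝ (Fin K)) - 1))) * h4

lemma integrable_exp_norm (K : ℕ) (c : ℝ) :
    Integrable (fun x => Real.exp (c * ‖x‖)) (stdGaussian (EuclideanSpace ℝ (Fin K))) := by
  obtain ⟨C, hC, h⟩ := IsGaussian.exists_integrable_exp_sq (stdGaussian (EuclideanSpace ℝ (Fin K)))
  refine (h.const_mul (Real.exp (c ^ 2 / (4 * C)))).mono' (by fun_prop) (ae_of_all _ fun x => ?_)
  rw [Real.norm_eq_abs, Real.abs_exp, ← Real.exp_add]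
  apply Real.exp_le_exp.2
  have : c ^ 2 / (4 * C) + C * ‖x‖ ^ 2 - c * ‖x‖ = C * (‖x‖ - c / (2 * C)) ^ 2 := by
    field_simp; ring
  have := mul_nonneg hC.le (sq_nonneg (‖x‖ - c / (2 * C)))
  linarith

lemma chord_in (θ d s : ℝ) (hd : 0 < d) (h : |s| ≤ d) :
    Real.exp (-θ * s) ≤ Real.cosh (θ * d) - Real.sinh (θ * d) / d * s := by
  obtain ⟨h1, h2⟩ := abs_le.1 h
  have hcv := convexOn_exp.2
  have := @hcv (θ * d) (Set.mem_univ _) (-(θ * d)) (Set.mem_univ _)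
    ((d - s) / (2 * d)) ((d + s) / (2 * d)) (by apply div_nonneg <;> linarith)
    (by apply div_nonneg <;> linarith) (by field_simp; ring)
  simp only [smul_eq_mul] at this
  have e1 : (d - s) / (2 * d) * (θ * d) + (d + s) / (2 * d) * -(θ * d) = -θ * s := by
    field_simp; ring
  rw [e1] at this
  refine this.trans (le_of_eq ?_)
  rw [Real.cosh_eq, Real.sinh_eq]; field_simp; ring

lemma chord_out' (θ d s : ℝ) (hd : 0 < d) (h : d ≤ s) :
    Real.cosh (θ * d) - Real.sinh (θ * d) / d * s ≤ Real.exp (-θ * s) := by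
  have hs : 0 < s + d := by linarith
  have hcv := convexOn_exp.2
  have := @hcv (-θ * s) (Set.mem_univ _) (θ * d) (Set.mem_univ _)
    (2 * d / (s + d)) ((s - d) / (s + d)) (by positivity)
    (by apply div_nonneg <;> linarith) (by field_simp; ring)
  simp only [smul_eq_mul] at this
  have e1 : 2 * d / (s + d) * (-θ * s) + (s - d) / (s + d) * (θ * d) = -(θ * d) := by
    field_simp; ring
  rw [e1] at this
  have h2 := mul_le_mul_of_nonneg_left this (by positivity : 0 ≤ (s + d) / (2 * d))
  have e2 : (s + d) / (2 * d) * (2 * d / (s + d) * Real.exp (-θ * s) + (s - d) / (s + d) * Real.exp (θ * d))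
     = Real.exp (-θ * s) + (s - d) / (2 * d) * Real.exp (θ * d) := by
    field_simp
  rw [e2] at h2
  have e3 : Real.cosh (θ * d) - Real.sinh (θ * d) / d * s =
    (s + d) / (2 * d) * Real.exp (-(θ * d)) - (s - d) / (2 * d) * Real.exp (θ * d) := by
    rw [Real.cosh_eq, Real.sinh_eq]; field_simp; ring
  rw [e3]; linarith

lemma chord_out (θ d s : ℝ) (hd : 0 < d) (h : d ≤ |s|) :
    Real.cosh (θ * d) - Real.sinh (θ * d) / d * s ≤ Real.exp (-θ * s) := by
  rcases le_total 0 s with h0 | h0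
  · rw [abs_of_nonneg h0] at h; exact chord_out' θ d s hd h
  · rw [abs_of_nonpos h0] at h
    have := chord_out' (-θ) d (-s) hd h
    simpa [Real.cosh_neg, Real.sinh_neg, neg_div] using this

section core
open RealInnerProductSpace
variable {K : ℕ}
local notation "EE" => EuclideanSpace ℝ (Fin K)

lemma stdGaussian_ac : stdGaussian EE ≪ (volume : Measure EE) := by
  rw [stdGaussian_dens]; exact withDensity_absolutelyContinuous _ _

lemma integral_norm_pos [Nontrivial EE] : 0 < ∫ x, ‖x‖ ∂(stdGaussian EE) := by
  refine lt_of_le_of_ne (integral_nonneg fun x => norm_nonneg x) fun h => ?_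
  have h0 := (integral_eq_zero_iff_of_nonneg (fun x => norm_nonneg x)
    (IsGaussian.integrable_id (μ := stdGaussian EE)).norm).1 h.symm
  have h1 : ∀ᵐ x ∂(stdGaussian EE), x ≠ 0 := by
    apply stdGaussian_ac.ae_le
    have : (volume : Measure EE) {0} = 0 := measure_singleton 0
    change ∀ᵐ x ∂(volume : Measure EE), x ≠ 0
    rw [ae_iff]; simp
  have : ∀ᵐ x ∂(stdGaussian EE), False := by
    filter_upwards [h0, h1] with x h2 h3
    exact h3 (by simpa using h2)
  have h4 := ae_iff.1 this
  simp at h4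

lemma integrable_of_exp_bound {q f : EE → ℝ} (hq : Measurable q) (hq0 : ∀ x, 0 ≤ q x)
    (hq1 : ∀ x, q x ≤ 1) (hf : Measurable f) (C c : ℝ) (h : ∀ x, |f x| ≤ C * Real.exp (c * ‖x‖)) :
    Integrable (fun x => q x * f x) (stdGaussian EE) := by
  refine ((integrable_exp_norm K c).const_mul C).mono' (by fun_prop) (ae_of_all _ fun x => ?_)
  rw [Real.norm_eq_abs, abs_mul, abs_of_nonneg (hq0 x)]
  calc q x * |f x| ≤ 1 * |f x| := by gcongr; exact hq1 x
    _ ≤ _ := by rw [one_mul]; exact h x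

lemma bound_exp (θ : ℝ) (w x : EE) :
    |Real.exp (-θ * ⟪w, x⟫)| ≤ 1 * Real.exp ((|θ| * ‖w‖) * ‖x‖) := by
  rw [Real.abs_exp, one_mul]
  apply Real.exp_le_exp.2
  calc -θ * ⟪w, x⟫ ≤ |-θ * ⟪w, x⟫| := le_abs_self _
    _ = |θ| * |⟪w, x⟫| := by rw [abs_mul, abs_neg]
    _ ≤ |θ| * (‖w‖ * ‖x‖) := by gcongr; exact abs_real_inner_le_norm w x
    _ = _ := by ring

lemma bound_cosh (y : ℝ) : |Real.cosh y| ≤ Real.exp |y| := by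
  rw [← Real.cosh_abs, abs_of_pos (Real.cosh_pos _), Real.cosh_eq]
  have : Real.exp (-|y|) ≤ Real.exp |y| := Real.exp_le_exp.2 (by linarith [abs_nonneg y])
  linarith

lemma bound_sinh (y : ℝ) : |Real.sinh y| ≤ Real.exp |y| := by
  refine le_trans ?_ (bound_cosh y)
  rw [abs_of_pos (Real.cosh_pos _), abs_le]
  have h1 := Real.cosh_add_sinh y
  have h2 := Real.cosh_sub_sinh y
  have := Real.exp_pos y
  have := Real.exp_pos (-y)
  constructor <;> linarith

/-- the comparison function -/
noncomputable def npf (θ c : ℝ) (w x : EE) : ℝ :=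
  Real.cosh (θ * (c * ‖x‖)) - Real.sinh (θ * (c * ‖x‖)) / (c * ‖x‖) * ⟪w, x⟫

lemma np_term [Nontrivial EE] (w : EE) (c θ : ℝ) (hc : 0 < c) (q : EE → ℝ) (hq : Measurable q)
    (hq0 : ∀ x, 0 ≤ q x) (hq1 : ∀ x, q x ≤ 1) (hh : ∀ c : ℝ, 0 < c → ∀ x, q (c • x) = q x)
    (hw : ∫ x, q x * ⟪w, x⟫ ∂(stdGaussian EE) = 0) :
    Integrable (fun x => q x * npf θ c w x) (stdGaussian EE) ∧
    ∫ x, q x * npf θ c w x ∂(stdGaussian EE) = (∫ x, q x ∂(stdGaussian EE)) *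
      ∫ x, Real.cosh (θ * (c * ‖x‖)) ∂(stdGaussian EE) := by
  have i1 : Integrable (fun x => q x * Real.cosh (θ * (c * ‖x‖))) (stdGaussian EE) := by
    refine integrable_of_exp_bound hq hq0 hq1 (by fun_prop) 1 (|θ| * c) fun x => ?_
    refine (bound_cosh _).trans (le_of_eq ?_)
    rw [abs_mul, abs_of_nonneg (by positivity : 0 ≤ c * ‖x‖), one_mul, mul_assoc]
  have i2 : Integrable (fun x => q x * (Real.sinh (θ * (c * ‖x‖)) / (c * ‖x‖) * ⟪w, x⟫))
      (stdGaussian EE) := by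
    refine integrable_of_exp_bound hq hq0 hq1 ?_ (‖w‖ / c) (|θ| * c) fun x => ?_
    · refine Measurable.mul (Measurable.div ?_ ?_) ?_ <;> fun_prop
    · have h1 := bound_sinh (θ * (c * ‖x‖))
      rw [abs_mul, abs_of_nonneg (by positivity : 0 ≤ c * ‖x‖), ← mul_assoc] at h1
      have h2 := abs_real_inner_le_norm w x
      rw [abs_mul, abs_div, abs_of_nonneg (by positivity : 0 ≤ c * ‖x‖)]
      rcases eq_or_ne x 0 with rfl | hx
      · simp; positivity
      have hx : 0 < ‖x‖ := norm_pos_iff.2 hx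
      calc _ ≤ Real.exp (|θ| * c * ‖x‖) / (c * ‖x‖) * (‖w‖ * ‖x‖) := by
            gcongr
            rw [mul_assoc]; rw [mul_assoc] at h1; exact h1
        _ = _ := by field_simp
  have e0 : (fun x => q x * npf θ c w x) = fun x => q x * Real.cosh (θ * (c * ‖x‖)) -
      q x * (Real.sinh (θ * (c * ‖x‖)) / (c * ‖x‖) * ⟪w, x⟫) := by
    ext x; unfold npf; ring
  refine ⟨by rw [e0]; exact i1.sub i2, ?_⟩
  rw [e0, integral_sub i1 i2]
  have hh' : ∀ c : ℝ, 0 < c → ∀ x, (fun x => q x * ⟪w, x⟫ / ‖x‖) (c • x) =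
      (fun x => q x * ⟪w, x⟫ / ‖x‖) x := by
    intro c hc x
    simp only [hh c hc, inner_smul_right, norm_smul, Real.norm_eq_abs, abs_of_pos hc]
    rcases eq_or_ne x 0 with rfl | hx
    · simp
    have hx : 0 < ‖x‖ := norm_pos_iff.2 hx
    field_simp
  have h1 := integral_hom_indep K q hh (fun r => Real.cosh (θ * (c * r)))
  have h2 := integral_hom_indep K (fun x => q x * ⟪w, x⟫ / ‖x‖) hh' (fun r => Real.sinh (θ * (c * r)) / (c * r) * r)
  have h3 := integral_hom_indep K (fun x => q x * ⟪w, x⟫ / ‖x‖) hh' (fun r => r)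
  have e3 : (fun x : EE => q x * ⟪w, x⟫ / ‖x‖ * ‖x‖) = fun x => q x * ⟪w, x⟫ := by
    ext x
    rcases eq_or_ne x 0 with rfl | hx
    · simp
    have hx : 0 < ‖x‖ := norm_pos_iff.2 hx
    field_simp
  have e2 : (fun x : EE => q x * ⟪w, x⟫ / ‖x‖ * (Real.sinh (θ * (c * ‖x‖)) / (c * ‖x‖) * ‖x‖)) =
      fun x => q x * (Real.sinh (θ * (c * ‖x‖)) / (c * ‖x‖) * ⟪w, x⟫) := by
    ext x
    rcases eq_or_ne x 0 with rfl | hx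
    · simp
    have hx : 0 < ‖x‖ := norm_pos_iff.2 hx
    field_simp
  simp only at h1 h2 h3
  rw [e3, hw] at h3
  rw [e2] at h2
  have : ∫ x, q x * ⟪w, x⟫ / ‖x‖ ∂(stdGaussian EE) = 0 := by
    rcases mul_eq_zero.1 h3.symm with h | h
    · exact h
    · exact absurd h integral_norm_pos.ne'
  rw [this, zero_mul] at h2
  rw [h1, h2, sub_zero]

lemma map_neg_stdGaussian : (stdGaussian EE).map (fun x => -x) = stdGaussian EE :=
  stdGaussian_map (LinearIsometryEquiv.neg ℝ (E := EE))

/-- the t-acceptance region -/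
def TT (w : EE) (c : ℝ) : Set EE := {x | |⟪w, x⟫| ≤ c * ‖x‖}

lemma measurableSet_TT (w : EE) (c : ℝ) : MeasurableSet (TT w c) := by
  apply measurableSet_le <;> fun_prop

lemma TT_smul (w : EE) (c r : ℝ) (hr : 0 < r) (x : EE) : r • x ∈ TT w c ↔ x ∈ TT w c := by
  simp only [TT, Set.mem_ofPred_eq, inner_smul_right, norm_smul, abs_mul, Real.norm_eq_abs,
    abs_of_pos hr]
  rw [show c * (r * ‖x‖) = r * (c * ‖x‖) by ring]
  exact mul_le_mul_iff_of_pos_left hr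

lemma np_core [Nontrivial EE] (w : EE) (c θ : ℝ) (hc : 0 < c) (k : EE → ℝ) (hk : Measurable k)
    (hk0 : ∀ x, 0 ≤ k x) (hk1 : ∀ x, k x ≤ 1) (hh : ∀ c : ℝ, 0 < c → ∀ x, k (c • x) = k x)
    (hw : ∫ x, k x * ⟪w, x⟫ ∂(stdGaussian EE) = 0)
    (hp : ∫ x, k x ∂(stdGaussian EE) = ∫ x, (TT w c).indicator 1 x ∂(stdGaussian EE)) :
    ∫ x, (TT w c).indicator 1 x * Real.exp (-θ * ⟪w, x⟫) ∂(stdGaussian EE) ≤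
    ∫ x, k x * Real.exp (-θ * ⟪w, x⟫) ∂(stdGaussian EE) := by
  set q : EE → ℝ := (TT w c).indicator 1 with hqdef
  have hq : Measurable q := measurable_one.indicator (measurableSet_TT w c)
  have hq0 : ∀ x, 0 ≤ q x := fun x => Set.indicator_nonneg (by simp) x
  have hq1 : ∀ x, q x ≤ 1 := fun x => Set.indicator_le_self' (by simp) x
  have hqh : ∀ c : ℝ, 0 < c → ∀ x, q (c • x) = q x := by
    intro r hr x
    by_cases h : x ∈ TT w c
    · simp [hqdef, h, (TT_smul w c r hr x).2 h]
    · simp [hqdef, h, mt (TT_smul w c r hr x).1 h]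
  have hqw : ∫ x, q x * ⟪w, x⟫ ∂(stdGaussian EE) = 0 := by
    have h1 : ∫ x, q x * ⟪w, x⟫ ∂(stdGaussian EE) = ∫ x, - (q x * ⟪w, x⟫) ∂(stdGaussian EE) := by
      conv_lhs => rw [← map_neg_stdGaussian]
      rw [integral_map (by fun_prop) (by fun_prop)]
      congr 1; ext x
      have : q (-x) = q x := by simp [hqdef, Set.indicator, TT]
      rw [this, inner_neg_right]; ring
    rw [integral_neg] at h1; linarith
  obtain ⟨ik, ek⟩ := np_term w c θ hc k hk hk0 hk1 hh hw
  obtain ⟨iq, eq⟩ := np_term w c θ hc q hq hq0 hq1 hqh hqw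
  have jk : Integrable (fun x => k x * Real.exp (-θ * ⟪w, x⟫)) (stdGaussian EE) :=
    integrable_of_exp_bound hk hk0 hk1 (by fun_prop) _ _ (bound_exp θ w)
  have jq : Integrable (fun x => q x * Real.exp (-θ * ⟪w, x⟫)) (stdGaussian EE) :=
    integrable_of_exp_bound hq hq0 hq1 (by fun_prop) _ _ (bound_exp θ w)
  have key := integral_mono (jq.sub iq) (jk.sub ik) (fun x => ?_)
  · simp only [Pi.sub_apply] at key
    rw [integral_sub jq iq, integral_sub jk ik, ek, eq, hp] at key
    linarith
  · simp only [Pi.sub_apply]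
    rcases eq_or_ne x 0 with rfl | hx
    · simp [npf]
    have hx : 0 < c * ‖x‖ := mul_pos hc (norm_pos_iff.2 hx)
    by_cases hT : x ∈ TT w c
    · have h1 := chord_in θ _ _ hx hT
      have : q x = 1 := by simp [hqdef, hT]
      rw [this]
      unfold npf
      nlinarith [hk0 x, hk1 x]
    · have h1 := chord_out θ _ _ hx (not_le.1 hT).le
      have : q x = 0 := by simp [hqdef, hT]
      rw [this]
      unfold npf
      nlinarith [hk0 x, hk1 x]

end core

section core2
open RealInnerProductSpace
variable {K : ℕ}
local notation "EE" => EuclideanSpace ℝ (Fin K)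

lemma power_eq (w : EE) (B : Set EE) (hB : MeasurableSet B) (δ : ℝ) :
    (stdGaussian EE).real {x | x - δ • w ∈ B} = Real.exp (-(δ ^ 2 * ‖w‖ ^ 2 / 2)) *
      ∫ x, B.indicator 1 x * Real.exp (-δ * ⟪w, x⟫) ∂(stdGaussian EE) := by
  have h := integral_shift K (B.indicator 1) (δ • w)
  have e1 : (fun x => B.indicator (1 : EE → ℝ) (x - δ • w)) =
      ({x | x - δ • w ∈ B} : Set EE).indicator 1 := by
    ext x; simp [Set.indicator]
  have hm : MeasurableSet ({x | x - δ • w ∈ B} : Set EE) :=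
    (measurable_id.sub_const (δ • w)) hB
  rw [e1, integral_indicator_one hm] at h
  rw [h, ← integral_const_mul]
  congr 1; ext x
  rw [inner_smul_left, norm_smul, mul_pow, Real.norm_eq_abs, sq_abs,
    show -((starRingEnd ℝ) δ * ⟪w, x⟫) - δ ^ 2 * ‖w‖ ^ 2 / 2 = -(δ ^ 2 * ‖w‖ ^ 2 / 2) + -δ * ⟪w, x⟫ by
      simp; ring, Real.exp_add]
  ring

lemma power_deriv (w : EE) (B : Set EE) (hB : MeasurableSet B) :
    HasDerivAt (fun δ : ℝ => (stdGaussian EE).real {x | x - δ • w ∈ B})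
      (-∫ x, B.indicator 1 x * ⟪w, x⟫ ∂(stdGaussian EE)) 0 := by
  have hi : integrableExpSet (fun x : EE => ⟪w, x⟫) ((stdGaussian EE).restrict B) = Set.univ := by
    refine Set.eq_univ_of_forall fun t => ?_
    have := integrable_of_exp_bound (q := fun _ : EE => (1 : ℝ)) measurable_const (by simp) (by simp)
      (by fun_prop) _ _ (bound_exp (-t) w)
    simp only [one_mul, neg_neg] at this
    exact this.restrict
  have hd := hasDerivAt_mgf (X := fun x : EE => ⟪w, x⟫) (μ := (stdGaussian EE).restrict B) (t := -0)
    (by rw [hi]; simp)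
  have hd2 := HasDerivAt.comp (0 : ℝ) hd (hasDerivAt_neg (0 : ℝ))
  have he : HasDerivAt (fun δ : ℝ => Real.exp (-(δ ^ 2 * ‖w‖ ^ 2 / 2))) 0 0 := by
    have h1 : HasDerivAt (fun δ : ℝ => (-(δ ^ 2 * ‖w‖ ^ 2 / 2))) 0 0 := by
      have := (((hasDerivAt_pow 2 (0 : ℝ)).mul_const (‖w‖ ^ 2)).div_const 2).neg
      have h3 := this.congr_deriv (g' := 0) (by simp)
      exact h3
    simpa using h1.exp
  have hp := he.mul hd2
  have ind : ∀ f : EE → ℝ, ∫ x, B.indicator 1 x * f x ∂(stdGaussian EE) =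
      ∫ x in B, f x ∂(stdGaussian EE) := by
    intro f
    rw [← integral_indicator hB]
    congr 1; ext x
    by_cases h : x ∈ B <;> simp [h]
  convert! hp using 1
  · ext δ
    rw [power_eq w B hB, ind]
    rfl
  · rw [ind]; simp

lemma power_stationary (w : EE) (B : Set EE) (hB : MeasurableSet B) (β : ℝ)
    (h0 : β ≤ (stdGaussian EE).real {x | x - (0 : ℝ) • w ∈ B})
    (h1 : ∀ δ : ℝ, δ ≠ 0 → (stdGaussian EE).real {x | x - δ • w ∈ B} ≤ β) :
    ∫ x, B.indicator 1 x ∂(stdGaussian EE) = β ∧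
    ∫ x, B.indicator 1 x * ⟪w, x⟫ ∂(stdGaussian EE) = 0 := by
  have hd := power_deriv w B hB
  have hmax : IsLocalMax (fun δ : ℝ => (stdGaussian EE).real {x | x - δ • w ∈ B}) 0 := by
    refine Eventually.of_forall fun δ => ?_
    rcases eq_or_ne δ 0 with rfl | h
    · exact le_rfl
    · exact (h1 δ h).trans h0
  have hz := hmax.hasDerivAt_eq_zero hd
  have hle : (stdGaussian EE).real {x | x - (0 : ℝ) • w ∈ B} ≤ β := by
    have hc := hd.continuousAt.tendsto.mono_left (nhdsWithin_le_nhds (s := {0}ᶜ))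
    refine le_of_tendsto hc ?_
    filter_upwards [self_mem_nhdsWithin] with δ hδ using h1 δ hδ
  refine ⟨?_, by linarith⟩
  rw [integral_indicator_one hB]
  have := le_antisymm hle h0
  simpa using this

lemma np_sets [Nontrivial EE] (w : EE) (c : ℝ) (hc : 0 < c) (β : ℝ)
    (hT : (stdGaussian EE).real (TT w c) = β)
    (B : Set EE) (hB : MeasurableSet B)
    (hcone : ∀ r : ℝ, 0 < r → ∀ x, r • x ∈ B ↔ x ∈ B)
    (h0 : β ≤ (stdGaussian EE).real {x | x - (0 : ℝ) • w ∈ B})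
    (h1 : ∀ δ : ℝ, δ ≠ 0 → (stdGaussian EE).real {x | x - δ • w ∈ B} ≤ β) (δ : ℝ) :
    (stdGaussian EE).real {x | x - δ • w ∈ TT w c} ≤
      (stdGaussian EE).real {x | x - δ • w ∈ B} := by
  obtain ⟨ha, hb⟩ := power_stationary w B hB β h0 h1
  rw [power_eq w B hB, power_eq w _ (measurableSet_TT w c)]
  refine mul_le_mul_of_nonneg_left ?_ (Real.exp_pos _).le
  refine np_core w c δ hc (B.indicator 1) (measurable_one.indicator hB)
    (fun x => Set.indicator_nonneg (by simp) x) (fun x => Set.indicator_le_self' (by simp) x) ?_ hb ?_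
  · intro r hr x
    by_cases h : x ∈ B
    · simp [h, (hcone r hr x).2 h]
    · simp [h, mt (hcone r hr x).1 h]
  · rw [ha, integral_indicator_one (measurableSet_TT w c), hT]

lemma np_unb [Nontrivial EE] (w : EE) (c : ℝ) (hc : 0 < c) (β : ℝ)
    (hT : (stdGaussian EE).real (TT w c) = β) (δ : ℝ) :
    (stdGaussian EE).real {x | x - δ • w ∈ TT w c} ≤ β := by
  have hu := power_eq w Set.univ MeasurableSet.univ δ
  simp at hu
  have hβ0 : 0 ≤ β := hT ▸ measureReal_nonneg
  have hβ1 : β ≤ 1 := hT ▸ measureReal_le_one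
  have := np_core w c δ hc (fun _ => β) measurable_const (fun _ => hβ0) (fun _ => hβ1) (by simp)
    (by
      rw [integral_const_mul]
      have := integral_strongDual_stdGaussian (innerSL ℝ w)
      simp only [innerSL_apply_apply] at this
      rw [this, mul_zero])
    (by rw [integral_indicator_one (measurableSet_TT w c), hT]; simp)
  rw [power_eq w _ (measurableSet_TT w c)]
  rw [integral_const_mul] at this
  calc _ ≤ Real.exp (-(δ ^ 2 * ‖w‖ ^ 2 / 2)) *
        (β * ∫ x, Real.exp (-δ * ⟪w, x⟫) ∂(stdGaussian EE)) := by gcongr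
    _ = β * (Real.exp (-(δ ^ 2 * ‖w‖ ^ 2 / 2)) * ∫ x, Real.exp (-δ * ⟪w, x⟫) ∂(stdGaussian EE)) := by
      ring
    _ = β := by simp only [neg_mul]; rw [← hu, mul_one]

lemma null_level (f : EE → ℝ) (hf : Measurable f) (w : EE)
    (h : ∀ c : ℝ, ∀ x, f (x + c • w) = f x + c) (δ : ℝ) :
    (stdGaussian EE) {x | f x = δ} = 0 := by
  apply stdGaussian_ac
  by_contra hne
  have hms : ∀ c : ℝ, MeasurableSet {x | f x = c} := fun c => hf (measurableSet_singleton c)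
  have hc := Measure.countable_meas_pos_of_disjoint_iUnion (μ := (volume : Measure EE))
    (As := fun c : ℝ => {x | f x = c}) hms (fun a b hab => by
      refine Set.disjoint_left.2 fun x hx hy => hab ?_
      exact hx.symm.trans hy)
  have hall : {c : ℝ | 0 < (volume : Measure EE) {x | f x = c}} = Set.univ := by
    refine Set.eq_univ_of_forall fun c => ?_
    have e : {x | f x = δ} = (fun x => x + (c - δ) • w) ⁻¹' {x | f x = c} := by
      ext x; simp [h]; constructor <;> intro h <;> linarith
    rw [e, measure_preimage_add_right] at hne
    exact pos_iff_ne_zero.2 hne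
  rw [hall] at hc
  exact Set.not_countable_univ hc

end core2


lemma chiSq_prob (n : ℕ) (hn : 0 < n) : IsProbabilityMeasure (chiSq n) :=
  isProbabilityMeasure_gammaMeasure (by positivity) (by norm_num)

lemma chiSq_integral (n : ℕ) (hn : 0 < n) (f : ℝ → ℝ) :
    ∫ q, f q ∂(chiSq n) = 2 * ((1 / 2 : ℝ) ^ ((n : ℝ) / 2) / Real.Gamma ((n : ℝ) / 2)) *
      ∫ y in Set.Ioi (0 : ℝ), y ^ (n - 1) * (Real.exp (-y ^ 2 / 2) * f (y ^ 2)) := by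
  have h0 : ∫ q, f q ∂(chiSq n) = ∫ q, gammaPDFReal ((n : ℝ) / 2) (1 / 2) q * f q := by
    rw [chiSq, gammaMeasure, integral_withDensity_eq_integral_toReal_smul]
    · simp only [gammaPDF, smul_eq_mul]
      congr 1; ext q
      rw [ENNReal.toReal_ofReal (gammaPDFReal_nonneg (by positivity) (by norm_num) q)]
    · exact (measurable_gammaPDFReal _ _).ennreal_ofReal
    · exact ae_of_all _ fun x => ENNReal.ofReal_lt_top
  have h1 : ∫ q, gammaPDFReal ((n : ℝ) / 2) (1 / 2) q * f q =
      ∫ q in Set.Ioi 0, gammaPDFReal ((n : ℝ) / 2) (1 / 2) q * f q := by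
    rw [← integral_Ici_eq_integral_Ioi]
    symm
    apply setIntegral_eq_integral_of_forall_compl_eq_zero
    intro x hx
    simp only [Set.mem_Ici, not_le] at hx
    simp [gammaPDFReal, not_le.2 hx]
  rw [h0, h1, ← integral_comp_rpow_Ioi _ (two_ne_zero), ← integral_const_mul]
  refine setIntegral_congr_fun measurableSet_Ioi fun y hy => ?_
  have hy : 0 < y := hy
  have hy2 : (0 : ℝ) ≤ y ^ 2 := by positivity
  simp only [Real.rpow_two, gammaPDFReal, hy2, if_true, smul_eq_mul]
  have e1 : (y ^ 2 : ℝ) ^ ((n : ℝ) / 2 - 1) * y = y ^ (n - 1) := by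
    rw [← Real.rpow_natCast y 2, ← Real.rpow_mul hy.le]
    conv_lhs => rw [← Real.rpow_one y]
    rw [← Real.rpow_mul hy.le, one_mul, ← Real.rpow_add hy, ← Real.rpow_natCast,
      Nat.cast_sub hn]
    congr 1; push_cast; ring
  rw [← e1, show -(1 / 2 * y ^ 2) = -y ^ 2 / 2 by ring]
  norm_num
  ring

lemma map_norm_sq (n : ℕ) (hn : 0 < n) :
    (stdGaussian (EuclideanSpace ℝ (Fin n))).map (fun x => ‖x‖ ^ 2) = chiSq n := by
  have := chiSq_prob n hn
  have : Nonempty (Fin n) := ⟨⟨0, hn⟩⟩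
  have hp : IsProbabilityMeasure
    ((stdGaussian (EuclideanSpace ℝ (Fin n))).map (fun x => ‖x‖ ^ 2)) :=
    Measure.isProbabilityMeasure_map (by fun_prop)
  obtain ⟨C, hC⟩ : ∃ C : ℝ, ∀ f : ℝ → ℝ, ∫ x, f (‖x‖ ^ 2) ∂(stdGaussian (EuclideanSpace ℝ (Fin n))) =
      C * ∫ y in Set.Ioi (0 : ℝ), y ^ (n - 1) * (Real.exp (-y ^ 2 / 2) * f (y ^ 2)) := by
    refine ⟨n * (volume : Measure (EuclideanSpace ℝ (Fin n))).real (Metric.ball 0 1) *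
      ((√(2 * Real.pi))⁻¹) ^ n, fun f => ?_⟩
    rw [integral_stdGaussian]
    have := integral_fun_norm_addHaar (volume : Measure (EuclideanSpace ℝ (Fin n)))
      (fun r => ((√(2 * Real.pi))⁻¹) ^ n * (Real.exp (-r ^ 2 / 2) * f (r ^ 2)))
    simp only [gdens, mul_assoc]
    rw [this, finrank_euclideanSpace_fin]
    simp only [nsmul_eq_mul, smul_eq_mul, ← integral_const_mul]
    congr 1; ext y; ring
  have hC2 := chiSq_integral n hn
  set D := 2 * ((1 / 2 : ℝ) ^ ((n : ℝ) / 2) / Real.Gamma ((n : ℝ) / 2))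
  have e1 := hC (fun _ => 1)
  have e2 := hC2 (fun _ => 1)
  simp only [integral_const, probReal_univ, smul_eq_mul, mul_one] at e1 e2
  have hCD : C = D := by
    have hI : (∫ y in Set.Ioi (0 : ℝ), y ^ (n - 1) * Real.exp (-y ^ 2 / 2)) ≠ 0 := by
      intro h; rw [h] at e1; simp at e1
    exact mul_right_cancel₀ hI (e1.symm.trans e2)
  ext s hs
  have hf : Measurable (s.indicator (1 : ℝ → ℝ)) := measurable_one.indicator hs
  have h1 := integral_map (μ := stdGaussian (EuclideanSpace ℝ (Fin n)))
    (φ := fun x => ‖x‖ ^ 2) (by fun_prop) (f := s.indicator (1 : ℝ → ℝ)) hf.aestronglyMeasurable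
  rw [hC, hCD, ← hC2, integral_indicator_one hs, integral_indicator_one hs] at h1
  exact (measureReal_eq_measureReal_iff).1 h1

lemma chiSq_ae_pos (n : ℕ) : ∀ᵐ q ∂(chiSq n), 0 < q := by
  have hac : chiSq n ≪ volume := withDensity_absolutelyContinuous _ _
  have h1 : chiSq n (Set.Iio 0) = 0 := by
    rw [chiSq, gammaMeasure, withDensity_apply _ measurableSet_Iio]
    rw [setLIntegral_congr_fun measurableSet_Iio (g := fun _ => 0)
      (fun x hx => gammaPDF_of_neg hx)]
    simp
  have h2 : chiSq n {0} = 0 := hac (measure_singleton _)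
  rw [ae_iff]
  have : {a : ℝ | ¬ 0 < a} = Set.Iio 0 ∪ {0} := by
    ext a; simp [le_iff_lt_or_eq]
  rw [this]
  exact measure_union_null h1 h2

lemma prod_ae_pos (n : ℕ) (hn : 0 < n) :
    ∀ᵐ p ∂((gaussianReal 0 1).prod (chiSq n)), 0 < √(p.2 / n) := by
  have := chiSq_prob n hn
  have h := (Measure.quasiMeasurePreserving_snd (μ := gaussianReal 0 1) (ν := chiSq n)).ae
    (chiSq_ae_pos n)
  filter_upwards [h] with p hp
  exact Real.sqrt_pos.2 (by positivity)

lemma studentT_prob (n : ℕ) (hn : 0 < n) : IsProbabilityMeasure (studentT n) := by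
  have := chiSq_prob n hn
  exact Measure.isProbabilityMeasure_map (by fun_prop)

lemma studentT_singleton (n : ℕ) (hn : 0 < n) (x : ℝ) : studentT n {x} = 0 := by
  have := chiSq_prob n hn
  have : NullSingletonClass (gaussianReal 0 1) :=
    ProbabilityTheory.nullSingletonClass_gaussianReal one_ne_zero
  rw [studentT, Measure.map_apply (by fun_prop) (measurableSet_singleton x)]
  have h1 : MeasurableSet {p : ℝ × ℝ | p.1 = x * √(p.2 / n)} := by
    apply measurableSet_eq_fun <;> fun_prop
  have h2 : ((gaussianReal 0 1).prod (chiSq n)) {p : ℝ × ℝ | p.1 = x * √(p.2 / n)} = 0 := by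
    rw [Measure.prod_apply_symm h1]
    have : ∀ y : ℝ, (gaussianReal 0 1) ((fun x => (x, y)) ⁻¹' {p : ℝ × ℝ | p.1 = x * √(p.2 / n)}) = 0 := by
      intro y
      have : ((fun x => (x, y)) ⁻¹' {p : ℝ × ℝ | p.1 = x * √(p.2 / n)}) = {x * √(y / n)} := by
        ext z; simp
      rw [this]; exact measure_singleton _
    simp only [this, lintegral_zero]
  refine measure_mono_null_ae ?_ h2
  filter_upwards [prod_ae_pos n hn] with p hp h
  exact (div_eq_iff hp.ne').1 h

lemma studentT_neg (n : ℕ) (hn : 0 < n) : (studentT n).map (fun x => -x) = studentT n := by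
  have := chiSq_prob n hn
  have hg : (gaussianReal 0 1).map (fun x => -x) = gaussianReal 0 1 := by
    rw [gaussianReal_map_neg]; simp
  have : ((gaussianReal 0 1).prod (chiSq n)).map (Prod.map (fun x => -x) id) =
      (gaussianReal 0 1).prod (chiSq n) := by
    rw [← Measure.map_prod_map _ _ (by fun_prop) (by fun_prop), hg, Measure.map_id]
  conv_rhs => rw [studentT, ← this]
  rw [studentT, Measure.map_map (by fun_prop) (by fun_prop),
    Measure.map_map (by fun_prop) (by fun_prop)]
  congr 1; ext p; simp [neg_div]

lemma studentT_symm (n : ℕ) (hn : 0 < n) (x : ℝ) :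
    (studentT n).real (Set.Iio (-x)) = 1 - (studentT n).real (Set.Iic x) := by
  have := studentT_prob n hn
  rw [← probReal_compl_eq_one_sub measurableSet_Iic]
  conv_lhs => rw [← studentT_neg n hn]
  rw [map_measureReal_apply (by fun_prop) measurableSet_Iio]
  congr 1; ext y; simp

lemma studentT_Iio (n : ℕ) (hn : 0 < n) (x : ℝ) :
    (studentT n).real (Set.Iio x) = (studentT n).real (Set.Iic x) := by
  have := studentT_prob n hn
  have h : NullSingletonClass (studentT n) := ⟨studentT_singleton n hn⟩
  exact measureReal_congr Iio_ae_eq_Iic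

lemma quantile_eq (n : ℕ) (hn : 0 < n) (p : ℝ) (hp0 : 0 < p) (hp1 : p < 1) :
    (studentT n).real (Set.Iic (tQuantile n p)) = p := by
  have := studentT_prob n hn
  set ν := studentT n
  have hF : ∀ x, ν.real (Set.Iic x) = cdf ν x := fun x => (cdf_eq_real ν x).symm
  set A : Set ℝ := {x : ℝ | p ≤ (ν (Set.Iic x)).toReal} with hA
  have hA' : ∀ x, x ∈ A ↔ p ≤ cdf ν x := fun x => by rw [← hF]; rfl
  have hne : A.Nonempty := by
    obtain ⟨x, hx⟩ := ((tendsto_cdf_atTop ν).eventually (lt_mem_nhds hp1)).exists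
    exact ⟨x, (hA' x).2 hx.le⟩
  have hbd : BddBelow A := by
    obtain ⟨x, hx⟩ := ((tendsto_cdf_atBot ν).eventually (gt_mem_nhds hp0)).exists
    refine ⟨x, fun y hy => ?_⟩
    by_contra hlt
    have := (cdf ν).mono (not_le.1 hlt).le
    have := (hA' y).1 hy
    linarith
  have ht : tQuantile n p = sInf A := rfl
  rw [ht, hF]
  apply le_antisymm
  · have hs := (cdf ν).measure_singleton (sInf A)
    rw [measure_cdf, studentT_singleton n hn] at hs
    have h1 : cdf ν (sInf A) ≤ Function.leftLim (cdf ν) (sInf A) := by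
      have := ENNReal.ofReal_eq_zero.1 hs.symm
      linarith
    refine h1.trans ?_
    refine le_of_tendsto ((cdf ν).mono.tendsto_leftLim (sInf A)) ?_
    filter_upwards [self_mem_nhdsWithin] with x hx
    by_contra h
    have : x ∈ A := (hA' x).2 (not_le.1 h).le
    exact absurd (csInf_le hbd this) (not_le.2 hx)
  · have hr := (cdf ν).right_continuous (sInf A)
    have hr2 : Tendsto (cdf ν) (𝓝[>] (sInf A)) (𝓝 (cdf ν (sInf A))) :=
      hr.tendsto.mono_left (nhdsWithin_mono _ Set.Ioi_subset_Ici_self)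
    refine ge_of_tendsto hr2 ?_
    filter_upwards [self_mem_nhdsWithin] with x hx
    obtain ⟨y, hy, hyx⟩ := exists_lt_of_csInf_lt hne hx
    exact ((hA' y).1 hy).trans ((cdf ν).mono hyx.le)

lemma quantile_pos (n : ℕ) (hn : 0 < n) (α : ℝ) (hα : α ∈ Set.Ioo (0 : ℝ) 1) :
    0 < tQuantile n (1 - α / 2) := by
  have := studentT_prob n hn
  obtain ⟨h0, h1⟩ := hα
  have hq := quantile_eq n hn (1 - α / 2) (by linarith) (by linarith)
  by_contra h
  have h2 : (studentT n).real (Set.Iic (tQuantile n (1 - α / 2))) ≤ (studentT n).real (Set.Iic 0) :=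
    measureReal_mono (Set.Iic_subset_Iic.2 (not_lt.1 h))
  have h3 := studentT_symm n hn 0
  rw [neg_zero, studentT_Iio n hn] at h3
  linarith

lemma studentT_Icc (n : ℕ) (hn : 0 < n) (α : ℝ) (hα : α ∈ Set.Ioo (0 : ℝ) 1) :
    (studentT n).real (Set.Icc (-tQuantile n (1 - α / 2)) (tQuantile n (1 - α / 2))) = 1 - α := by
  have := studentT_prob n hn
  have hpos := quantile_pos n hn α hα
  obtain ⟨h0, h1⟩ := hα
  have hq := quantile_eq n hn (1 - α / 2) (by linarith) (by linarith)
  set t := tQuantile n (1 - α / 2)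
  have h3 := studentT_symm n hn t
  have e : Set.Icc (-t) t = Set.Iic t \ Set.Iio (-t) := by
    ext x; simp [and_comm]
  rw [e, measureReal_sdiff (by intro x hx; simp at hx ⊢; linarith) measurableSet_Iio, h3, hq]
  ring

section
open RealInnerProductSpace

lemma region_prob (n : ℕ) (hn : 0 < n) (e : EuclideanSpace ℝ (Fin (n + 1))) (he : ‖e‖ = 1) (t : ℝ) :
    (stdGaussian (EuclideanSpace ℝ (Fin (n + 1)))).real
      {x | |⟪e, x⟫| ≤ t * √((‖x‖ ^ 2 - ⟪e, x⟫ ^ 2) / n)} = (studentT n).real (Set.Icc (-t) t) := by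
  have := chiSq_prob n hn
  obtain ⟨b, hb⟩ := Orthonormal.exists_orthonormalBasis_extension_of_card_eq (𝕜 := ℝ)
    (E := EuclideanSpace ℝ (Fin (n + 1))) (ι := Fin (n + 1)) (by simp) (v := fun _ => e) (s := {0})
    (by
      refine ⟨fun i => he, fun i j hij => absurd (Subsingleton.elim i j) hij⟩)
  have hb0 : b 0 = e := hb 0 rfl
  rw [stdGaussian_eq_map_pi_orthonormalBasis b, map_measureReal_apply (by fun_prop)
    (measurableSet_le (by fun_prop) (by fun_prop))]
  have h1 : ∀ x : Fin (n + 1) → ℝ, ⟪e, ∑ i, x i • b i⟫ = x 0 := by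
    intro x
    rw [← hb0, b.orthonormal.inner_right_fintype]
  have h2 : ∀ x : Fin (n + 1) → ℝ, ‖∑ i, x i • b i‖ ^ 2 - (x 0) ^ 2 =
      ‖(WithLp.toLp 2 (fun i => x (Fin.succ i)) : EuclideanSpace ℝ (Fin n))‖ ^ 2 := by
    intro x
    have := b.sum_sq_norm_inner_right (∑ i, x i • b i)
    simp only [b.orthonormal.inner_right_fintype, Real.norm_eq_abs, sq_abs] at this
    rw [← this, EuclideanSpace.real_norm_sq_eq, Fin.sum_univ_succ]
    simp
  have hmp := measurePreserving_piFinSuccAbove (fun _ : Fin (n + 1) => gaussianReal 0 1) 0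
  have hset : (fun x : Fin (n + 1) → ℝ => ∑ i, x i • b i) ⁻¹'
      {x | |⟪e, x⟫| ≤ t * √((‖x‖ ^ 2 - ⟪e, x⟫ ^ 2) / n)} =
      (MeasurableEquiv.piFinSuccAbove (fun _ : Fin (n + 1) => ℝ) 0) ⁻¹'
        (Prod.map id (fun y : Fin n → ℝ => ‖(WithLp.toLp 2 y : EuclideanSpace ℝ (Fin n))‖ ^ 2) ⁻¹'
          {p : ℝ × ℝ | |p.1| ≤ t * √(p.2 / n)}) := by
    ext x
    simp only [Set.mem_preimage, Set.mem_ofPred_eq, h1, h2]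
    rfl
  have hm2 : MeasurableSet {p : ℝ × ℝ | |p.1| ≤ t * √(p.2 / n)} :=
    measurableSet_le (by fun_prop) (by fun_prop)
  have hmf : Measurable (fun y : Fin n → ℝ => ‖(WithLp.toLp 2 y : EuclideanSpace ℝ (Fin n))‖ ^ 2) := by
    fun_prop
  have hmap : (Measure.pi fun _ : Fin n => gaussianReal 0 1).map
      (fun y : Fin n → ℝ => ‖(WithLp.toLp 2 y : EuclideanSpace ℝ (Fin n))‖ ^ 2) = chiSq n := by
    rw [← map_norm_sq n hn, ← map_pi_eq_stdGaussian, Measure.map_map (by fun_prop) (by fun_prop)]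
    rfl
  rw [hset, hmp.measureReal_preimage ((measurable_id.prodMap hmf) hm2).nullMeasurableSet,
    ← map_measureReal_apply (measurable_id.prodMap hmf) hm2,
    ← Measure.map_prod_map _ _ measurable_id hmf, hmap, Measure.map_id]
  rw [studentT, map_measureReal_apply (by fun_prop) measurableSet_Icc]
  apply measureReal_congr
  filter_upwards [prod_ae_pos n hn] with p hp
  apply propext
  change |p.1| ≤ t * √(p.2 / n) ↔ p.1 / √(p.2 / n) ∈ Set.Icc (-t) t
  rw [Set.mem_Icc, ← abs_le, abs_div, abs_of_pos hp, div_le_iff₀ hp]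

lemma region_iff (N s n t : ℝ) (hN : 0 ≤ N) (hs : s ^ 2 ≤ N ^ 2) (hn : 0 < n) (ht : 0 < t) :
    |s| ≤ t * √((N ^ 2 - s ^ 2) / n) ↔ |s| ≤ t / √(n + t ^ 2) * N := by
  have hpos : 0 < n + t ^ 2 := by positivity
  have h1 : 0 ≤ (N ^ 2 - s ^ 2) / n := div_nonneg (by linarith) hn.le
  rw [← sq_le_sq₀ (abs_nonneg s) (by positivity), ← sq_le_sq₀ (abs_nonneg s) (by positivity : 0 ≤ t / √(n + t ^ 2) * N),
    sq_abs, mul_pow, Real.sq_sqrt h1, mul_pow, div_pow, Real.sq_sqrt hpos.le]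
  rw [← mul_div_assoc, le_div_iff₀ hn, div_mul_eq_mul_div, le_div_iff₀ hpos]
  constructor <;> intro h <;> nlinarith

lemma TT_prob (n : ℕ) (hn : 0 < n) (w : EuclideanSpace ℝ (Fin (n + 1))) (hw : w ≠ 0)
    (α : ℝ) (hα : α ∈ Set.Ioo (0 : ℝ) 1) :
    (stdGaussian (EuclideanSpace ℝ (Fin (n + 1)))).real
      (TT w (‖w‖ * (tQuantile n (1 - α / 2) / √(n + tQuantile n (1 - α / 2) ^ 2)))) = 1 - α := by
  have hw' : 0 < ‖w‖ := norm_pos_iff.2 hw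
  have ht := quantile_pos n hn α hα
  have he : ‖‖w‖⁻¹ • w‖ = 1 := by simp [norm_smul, hw'.ne']
  rw [← studentT_Icc n hn α hα, ← region_prob n hn (‖w‖⁻¹ • w) he]
  congr 1; ext x
  simp only [TT, Set.mem_ofPred_eq]
  rw [region_iff _ _ _ _ (norm_nonneg x) _ (by positivity) ht]
  · rw [inner_smul_left, abs_mul]
    simp only [map_inv₀, conj_trivial, abs_inv, abs_norm]
    rw [inv_mul_le_iff₀ hw', mul_assoc]
  · have := abs_real_inner_le_norm (‖w‖⁻¹ • w) x
    rw [he, one_mul] at this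
    rw [← sq_abs]; gcongr
end

section fin
open RealInnerProductSpace
variable {K : ℕ}
local notation "EE" => EuclideanSpace ℝ (Fin K)

/-- pulled-back acceptance region -/
def accB (A : Matrix (Fin K) (Fin K) ℝ) (L U : (Fin K → ℝ) → ℝ) : Set EE :=
  {x | L (A *ᵥ x.ofLp) ≤ 0 ∧ 0 ≤ U (A *ᵥ x.ofLp)}

lemma cont_mulVec_ofLp (A : Matrix (Fin K) (Fin K) ℝ) :
    Continuous (fun x : EE => A *ᵥ x.ofLp) := by fun_prop

lemma accB_meas (A : Matrix (Fin K) (Fin K) ℝ) (L U : (Fin K → ℝ) → ℝ) (h : Homogeneous L U) :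
    MeasurableSet (accB A L U) := by
  have hc := cont_mulVec_ofLp A
  exact ((isClosed_le (h.2.2.1.comp hc) continuous_const).inter
    (isClosed_le continuous_const (h.2.2.2.comp hc))).measurableSet

lemma accB_cone (A : Matrix (Fin K) (Fin K) ℝ) (L U : (Fin K → ℝ) → ℝ) (h : Homogeneous L U)
    (r : ℝ) (hr : 0 < r) (x : EE) : r • x ∈ accB A L U ↔ x ∈ accB A L U := by
  simp only [accB, Set.mem_ofPred_eq, WithLp.ofLp_smul, Matrix.mulVec_smul]
  rw [(h.1 r hr _).1, (h.1 r hr _).2]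
  constructor
  · rintro ⟨h1, h2⟩
    exact ⟨by by_contra hh; nlinarith [mul_pos hr (not_le.1 hh)],
      nonneg_of_mul_nonneg_right h2 hr⟩
  · rintro ⟨h1, h2⟩
    exact ⟨mul_nonpos_of_nonneg_of_nonpos hr.le h1, mul_nonneg hr.le h2⟩

lemma accB_shift (A : Matrix (Fin K) (Fin K) ℝ) (L U : (Fin K → ℝ) → ℝ) (h : Homogeneous L U)
    (w : EE) (hw : A *ᵥ w.ofLp = 1) (δ : ℝ) :
    {x : EE | x - δ • w ∈ accB A L U} =
      (fun x : EE => A *ᵥ x.ofLp) ⁻¹' {z | L z ≤ δ ∧ δ ≤ U z} := by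
  ext x
  simp only [accB, Set.mem_ofPred_eq, Set.mem_preimage, WithLp.ofLp_sub, WithLp.ofLp_smul,
    Matrix.mulVec_sub, Matrix.mulVec_smul, hw]
  rw [sub_eq_add_neg, ← neg_smul, (h.2.1 _ _).1, (h.2.1 _ _).2]
  constructor <;> rintro ⟨h1, h2⟩ <;> constructor <;> linarith

lemma conv_lemma {Ω : Type*} [MeasurableSpace Ω] (P : Measure Ω) [IsProbabilityMeasure P] (ψ : ℝ)
    (Y : ℕ → Ω → Fin K → ℝ) (hYmeas : ∀ n, Measurable (Y n))
    (A : Matrix (Fin K) (Fin K) ℝ) (w : EE) (hw : A *ᵥ w.ofLp = 1)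
    (hCLT : TendstoInDist P (fun n ω => Real.sqrt n • (Y n ω - ψ • 1))
      ((stdGaussian EE).map (fun x => A *ᵥ x.ofLp)))
    (L U : (Fin K → ℝ) → ℝ) (h : Homogeneous L U) (δ : ℝ) :
    Tendsto (fun n => (P {ω | L (Y n ω) ≤ ψ + δ / Real.sqrt n ∧
          ψ + δ / Real.sqrt n ≤ U (Y n ω)}).toReal) atTop
      (𝓝 ((stdGaussian EE).real {x | x - δ • w ∈ accB A L U})) := by
  have hc := cont_mulVec_ofLp A
  set μ := (stdGaussian EE).map (fun x => A *ᵥ x.ofLp) with hμ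
  have hμp : IsProbabilityMeasure μ := Measure.isProbabilityMeasure_map (by fun_prop)
  have hZ : ∀ n : ℕ, Measurable (fun ω => Real.sqrt n • (Y n ω - ψ • (1 : Fin K → ℝ))) := fun n =>
    Measurable.const_smul (g := fun ω => Y n ω - ψ • (1 : Fin K → ℝ))
      ((hYmeas n).sub_const _) (Real.sqrt n)
  have hZp : ∀ n : ℕ, IsProbabilityMeasure
    (P.map (fun ω => Real.sqrt n • (Y n ω - ψ • (1 : Fin K → ℝ)))) := fun n =>
    Measure.isProbabilityMeasure_map (hZ n).aemeasurable
  let μs : ℕ → ProbabilityMeasure (Fin K → ℝ) := fun n => ⟨_, hZp n⟩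
  let μ0 : ProbabilityMeasure (Fin K → ℝ) := ⟨μ, hμp⟩
  have ht : Tendsto μs atTop (𝓝 μ0) := by
    refine ProbabilityMeasure.tendsto_iff_forall_integral_tendsto.2 ?_
    intro f
    refine (hCLT f).congr fun n => ?_
    exact (integral_map (hZ n).aemeasurable f.continuous.aestronglyMeasurable).symm
  set S : Set (Fin K → ℝ) := {z | L z ≤ δ ∧ δ ≤ U z} with hS
  have hSm : MeasurableSet S := ((isClosed_le h.2.2.1 continuous_const).inter
    (isClosed_le continuous_const h.2.2.2)).measurableSet
  have null : ∀ f : (Fin K → ℝ) → ℝ, Continuous f →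
      (∀ c : ℝ, ∀ x, f (x + c • 1) = f x + c) → μ {z | f z = δ} = 0 := by
    intro f hf hf1
    have hmm : MeasurableSet {z | f z = δ} := hf.measurable (measurableSet_singleton δ)
    rw [hμ, Measure.map_apply hc.measurable hmm]
    refine null_level (fun x : EE => f (A *ᵥ x.ofLp)) (hf.comp hc).measurable w (fun c x => ?_) δ
    simp only [WithLp.ofLp_add, WithLp.ofLp_smul, Matrix.mulVec_add, Matrix.mulVec_smul, hw, hf1]
  have hfr : μ (frontier S) = 0 := by
    have hsub : frontier S ⊆ {z | L z = δ} ∪ {z | U z = δ} := by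
      have h1 : S = {z | L z ≤ δ} ∩ {z | δ ≤ U z} := rfl
      rw [h1]
      refine (frontier_inter_subset _ _).trans ?_
      rintro z (⟨hz, -⟩ | ⟨-, hz⟩)
      · exact Or.inl (frontier_le_subset_eq h.2.2.1 continuous_const hz)
      · exact Or.inr (frontier_le_subset_eq continuous_const h.2.2.2 hz).symm
    exact measure_mono_null hsub (measure_union_null
      (null L h.2.2.1 fun c x => (h.2.1 c x).1) (null U h.2.2.2 fun c x => (h.2.1 c x).2))
  have hlim := ProbabilityMeasure.tendsto_measure_of_null_frontier_of_tendsto' ht hfr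
  have hlim2 := (ENNReal.tendsto_toReal (measure_ne_top μ S)).comp hlim
  have hval : (stdGaussian EE).real {x | x - δ • w ∈ accB A L U} = (μ S).toReal := by
    rw [accB_shift A L U h w hw, hμ, Measure.map_apply hc.measurable hSm]; rfl
  rw [hval]
  refine hlim2.congr' ?_
  filter_upwards [eventually_ge_atTop 1] with n hn
  have hn : 0 < √(n : ℝ) := Real.sqrt_pos.2 (by exact_mod_cast hn)
  simp only [Function.comp, μs, ProbabilityMeasure.coe_mk]
  rw [Measure.map_apply (hZ n) hSm]
  congr 2
  ext ω
  simp only [hS, Set.mem_preimage, Set.mem_ofPred_eq]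
  rw [(h.1 _ hn _).1, (h.1 _ hn _).2, sub_eq_add_neg, ← neg_smul, (h.2.1 _ _).1, (h.2.1 _ _).2]
  rw [← le_div_iff₀' hn, ← div_le_iff₀' hn]
  constructor <;> rintro ⟨h1, h2⟩ <;> constructor <;> linarith

lemma sig_inv (A Sig : Matrix (Fin K) (Fin K) ℝ) (hSig : Sig.PosDef) (σ : ℝ) (hσ : 0 < σ)
    (hA : σ ^ 2 • Sig = A * Aᵀ) : IsUnit A.det ∧ ∀ x y : Fin K → ℝ,
      (A *ᵥ x) ⬝ᵥ (Sig⁻¹ *ᵥ (A *ᵥ y)) = σ ^ 2 * (x ⬝ᵥ y) := by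
  have hS : IsUnit Sig.det := hSig.det_pos.ne'.isUnit
  have hdet : A.det ≠ 0 := by
    intro h0
    have h1 := congrArg Matrix.det hA
    rw [Matrix.det_mul, h0, zero_mul, Matrix.det_smul] at h1
    have := hSig.det_pos
    have : 0 < (σ ^ 2) ^ Fintype.card (Fin K) * Sig.det := by positivity
    linarith
  have hT : IsUnit Aᵀ.det := by rw [Matrix.det_transpose]; exact hdet.isUnit
  have key : Sig⁻¹ * A = σ ^ 2 • (Aᵀ)⁻¹ := by
    have h1 : Sig * (σ ^ 2 • (Aᵀ)⁻¹) = A := by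
      rw [Matrix.mul_smul, ← Matrix.smul_mul, hA, Matrix.mul_assoc, Matrix.mul_nonsing_inv _ hT,
        Matrix.mul_one]
    calc Sig⁻¹ * A = Sig⁻¹ * (Sig * (σ ^ 2 • (Aᵀ)⁻¹)) := by rw [h1]
      _ = _ := by rw [← Matrix.mul_assoc, Matrix.nonsing_inv_mul _ hS, Matrix.one_mul]
  refine ⟨hdet.isUnit, fun x y => ?_⟩
  rw [Matrix.mulVec_mulVec, key, ← Matrix.vecMul_transpose, ← Matrix.dotProduct_mulVec,
    Matrix.mulVec_mulVec, Matrix.mul_smul, Matrix.mul_nonsing_inv _ hT, Matrix.smul_mulVec,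
    Matrix.one_mulVec, dotProduct_smul, smul_eq_mul]

end fin


section fin2
open RealInnerProductSpace
variable {K : ℕ}
local notation "EE" => EuclideanSpace ℝ (Fin K)

lemma gs_homog (Sig : Matrix (Fin K) (Fin K) ℝ) (lam k t : ℝ) (hl : 0 < lam)
    (hlam : lam = (1 : Fin K → ℝ) ⬝ᵥ Sig⁻¹.mulVec 1)
    (m : (Fin K → ℝ) → ℝ) (hm : ∀ y, m y = ((1 : Fin K → ℝ) ⬝ᵥ Sig⁻¹.mulVec y) / lam)
    (S : (Fin K → ℝ) → ℝ)
    (hS : ∀ y, S y = Real.sqrt ((1 / (lam * k)) *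
      ((y - m y • 1) ⬝ᵥ Sig⁻¹.mulVec (y - m y • 1))))
    (LGS UGS : (Fin K → ℝ) → ℝ)
    (hLGS : ∀ y, LGS y = m y - t * S y)
    (hUGS : ∀ y, UGS y = m y + t * S y) : Homogeneous LGS UGS := by
  have m1 : ∀ (c : ℝ) x, m (c • x) = c * m x := by
    intro c x
    rw [hm, hm, Matrix.mulVec_smul, dotProduct_smul, smul_eq_mul, mul_div_assoc]
  have m2 : ∀ (c : ℝ) x, m (x + c • 1) = m x + c := by
    intro c x
    rw [hm, hm, Matrix.mulVec_add, Matrix.mulVec_smul, dotProduct_add, dotProduct_smul,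
      smul_eq_mul, ← hlam]
    field_simp
  have s1 : ∀ (c : ℝ), 0 < c → ∀ x, S (c • x) = c * S x := by
    intro c hc x
    rw [hS, hS, m1, ← smul_smul, ← smul_sub, Matrix.mulVec_smul, dotProduct_smul, smul_dotProduct,
      smul_eq_mul, smul_eq_mul]
    rw [show ∀ a b : ℝ, a * (c * (c * b)) = c ^ 2 * (a * b) by intros; ring,
      Real.sqrt_mul (by positivity), Real.sqrt_sq hc.le]
  have s2 : ∀ (c : ℝ) x, S (x + c • 1) = S x := by
    intro c x
    rw [hS, hS, m2, add_smul, add_sub_add_right_eq_sub]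
  have mc : Continuous m := by
    rw [show m = fun y => ((1 : Fin K → ℝ) ⬝ᵥ Sig⁻¹.mulVec y) / lam from funext hm]
    fun_prop
  have sc : Continuous S := by
    rw [funext hS]
    fun_prop
  refine ⟨fun c hc x => ⟨?_, ?_⟩, fun c x => ⟨?_, ?_⟩, ?_, ?_⟩
  · rw [hLGS, hLGS, m1, s1 c hc]; ring
  · rw [hUGS, hUGS, m1, s1 c hc]; ring
  · rw [hLGS, hLGS, m2, s2]; ring
  · rw [hUGS, hUGS, m2, s2]; ring
  · rw [funext hLGS]; fun_prop
  · rw [funext hUGS]; fun_prop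

lemma dot_inner (x y : EE) : x.ofLp ⬝ᵥ y.ofLp = ⟪x, y⟫ := by
  rw [PiLp.inner_apply, dotProduct]
  refine Finset.sum_congr rfl fun i _ => ?_
  simp [mul_comm]

lemma gs_accB (A Sig : Matrix (Fin K) (Fin K) ℝ) (σ lam k t : ℝ) (hσ : 0 < σ) (hk : 0 < k)
    (ht : 0 < t) (w : EE) (hw0 : w ≠ 0) (hw : A *ᵥ w.ofLp = 1)
    (hA : ∀ x y : Fin K → ℝ, (A *ᵥ x) ⬝ᵥ (Sig⁻¹ *ᵥ (A *ᵥ y)) = σ ^ 2 * (x ⬝ᵥ y))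
    (hlam : lam = σ ^ 2 * ‖w‖ ^ 2)
    (m : (Fin K → ℝ) → ℝ) (hm : ∀ y, m y = ((1 : Fin K → ℝ) ⬝ᵥ Sig⁻¹.mulVec y) / lam)
    (S : (Fin K → ℝ) → ℝ)
    (hS : ∀ y, S y = Real.sqrt ((1 / (lam * k)) *
      ((y - m y • 1) ⬝ᵥ Sig⁻¹.mulVec (y - m y • 1))))
    (LGS UGS : (Fin K → ℝ) → ℝ)
    (hLGS : ∀ y, LGS y = m y - t * S y)
    (hUGS : ∀ y, UGS y = m y + t * S y) :
    accB A LGS UGS = TT w (‖w‖ * (t / √(k + t ^ 2))) := by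
  have hw' : 0 < ‖w‖ := norm_pos_iff.2 hw0
  ext x
  have em : m (A *ᵥ x.ofLp) = ⟪w, x⟫ / ‖w‖ ^ 2 := by
    rw [hm, ← hw, hA, dot_inner, hlam]; field_simp
  have eS : S (A *ᵥ x.ofLp) = √((‖x‖ ^ 2 - (⟪w, x⟫ / ‖w‖) ^ 2) / k) / ‖w‖ := by
    have h1 : A *ᵥ x.ofLp - m (A *ᵥ x.ofLp) • (1 : Fin K → ℝ) =
        A *ᵥ (x - (⟪w, x⟫ / ‖w‖ ^ 2) • w).ofLp := by
      rw [em, WithLp.ofLp_sub, WithLp.ofLp_smul, Matrix.mulVec_sub, Matrix.mulVec_smul, hw]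
    rw [hS, h1, hA, dot_inner, real_inner_self_eq_norm_sq, norm_sub_sq_real, inner_smul_right,
      norm_smul, mul_pow, real_inner_comm, Real.norm_eq_abs, sq_abs, hlam]
    rw [eq_div_iff hw'.ne']
    conv_lhs => rw [← Real.sqrt_sq hw'.le]
    rw [← Real.sqrt_mul' _ (by positivity)]
    congr 1
    rw [Real.sqrt_sq hw'.le]
    field_simp
    ring
  have hs : (⟪w, x⟫ / ‖w‖) ^ 2 ≤ ‖x‖ ^ 2 := by
    rw [← sq_abs, abs_div, abs_norm]
    gcongr
    rw [div_le_iff₀' hw']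
    exact abs_real_inner_le_norm w x
  simp only [accB, TT, Set.mem_ofPred_eq]
  rw [hLGS, hUGS, em, eS]
  have hr := region_iff ‖x‖ (⟪w, x⟫ / ‖w‖) k t (norm_nonneg x) hs hk ht
  rw [abs_div, abs_norm, div_le_iff₀' hw', div_le_iff₀' hw'] at hr
  rw [mul_assoc, ← hr]
  set R := √((‖x‖ ^ 2 - (⟪w, x⟫ / ‖w‖) ^ 2) / k)
  have e1 : ⟪w, x⟫ / ‖w‖ ^ 2 - t * (R / ‖w‖) = (⟪w, x⟫ - ‖w‖ * (t * R)) / ‖w‖ ^ 2 := by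
    field_simp
  have e2 : ⟪w, x⟫ / ‖w‖ ^ 2 + t * (R / ‖w‖) = (⟪w, x⟫ + ‖w‖ * (t * R)) / ‖w‖ ^ 2 := by
    field_simp
  rw [e1, e2, div_le_iff₀ (by positivity), le_div_iff₀ (by positivity), abs_le]
  constructor <;> rintro ⟨h1, h2⟩ <;> constructor <;> linarith

lemma gauss_map (A : Matrix (Fin K) (Fin K) ℝ) :
    (stdGaussianPi K).map (fun ξ => 0 + A.mulVec ξ) =
      (stdGaussian EE).map (fun x => A *ᵥ x.ofLp) := by
  rw [← map_pi_eq_stdGaussian, Measure.map_map (by fun_prop) (by fun_prop)]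
  simp only [zero_add]
  rfl

end fin2

/-- Given Stage 1 estimates with Gaussian limit `N(0, σ²Σ)` (`Σ` known positive
definite), the interval `CI_GS(y) = m(y) ± t_{K-1,1-α/2} S(y)` is asymptotically uniformly most
accurate unbiased among homogeneous confidence intervals. -/
theorem stmt2 {Ω : Type*} [MeasurableSpace Ω] (P : Measure Ω) [IsProbabilityMeasure P]
    (K : ℕ) (hK : 2 ≤ K) (α : ℝ) (hα : α ∈ Set.Ioo (0 : ℝ) 1) (ψ : ℝ)
    (Sig : Matrix (Fin K) (Fin K) ℝ) (hSig : Sig.PosDef)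
    (lam : ℝ) (hlam : lam = (1 : Fin K → ℝ) ⬝ᵥ Sig⁻¹.mulVec 1)
    (Y : ℕ → Ω → Fin K → ℝ) (hYmeas : ∀ n, Measurable (Y n))
    (σ : ℝ) (hσ : 0 < σ) (μlim : Measure (Fin K → ℝ))
    (hGauss : IsGaussianVec μlim 0 (σ ^ 2 • Sig))
    (hCLT : TendstoInDist P (fun n ω => Real.sqrt n • (Y n ω - ψ • 1)) μlim)
    (m : (Fin K → ℝ) → ℝ) (hm : ∀ y, m y = ((1 : Fin K → ℝ) ⬝ᵥ Sig⁻¹.mulVec y) / lam)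
    (S : (Fin K → ℝ) → ℝ)
    (hS : ∀ y, S y = Real.sqrt ((1 / (lam * ((K : ℝ) - 1))) *
      ((y - m y • 1) ⬝ᵥ Sig⁻¹.mulVec (y - m y • 1))))
    (LGS UGS : (Fin K → ℝ) → ℝ)
    (hLGS : ∀ y, LGS y = m y - tQuantile ((K : ℝ) - 1) (1 - α / 2) * S y)
    (hUGS : ∀ y, UGS y = m y + tQuantile ((K : ℝ) - 1) (1 - α / 2) * S y) :
    ∃ ℓ : ℝ → ℝ,
      -- (i) the coverage of every local alternative under `CI_GS` converges,
      (∀ δ : ℝ, Tendsto (fun n => (P {ω | LGS (Y n ω) ≤ ψ + δ / Real.sqrt n ∧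
          ψ + δ / Real.sqrt n ≤ UGS (Y n ω)}).toReal) atTop (𝓝 (ℓ δ))) ∧
      ℓ 0 = 1 - α ∧ (∀ δ : ℝ, δ ≠ 0 → ℓ δ ≤ 1 - α) ∧
      -- (ii) `CI_GS` is asymptotically UMA unbiased among homogeneous CIs
      (∀ L U : (Fin K → ℝ) → ℝ, Homogeneous L U → AsympUnbiased P Y ψ α L U →
        ∀ δ : ℝ, δ ≠ 0 →
          ℓ δ ≤ limsup (fun n => (P {ω | L (Y n ω) ≤ ψ + δ / Real.sqrt n ∧
            ψ + δ / Real.sqrt n ≤ U (Y n ω)}).toReal) atTop) := by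
  obtain ⟨n, rfl⟩ : ∃ n, K = n + 1 := ⟨K - 1, by omega⟩
  have hn : 0 < n := by omega
  have hkn : (((n + 1 : ℕ) : ℝ) - 1) = n := by push_cast; ring
  rw [hkn] at hLGS hUGS
  simp only [hkn] at hS
  obtain ⟨A, hA, hμ⟩ := hGauss
  rw [gauss_map] at hμ
  subst hμ
  obtain ⟨hdet, hinv⟩ := sig_inv A Sig hSig σ hσ hA
  set w : EuclideanSpace ℝ (Fin (n + 1)) := WithLp.toLp 2 (A⁻¹ *ᵥ 1) with hwdef
  have hw : A *ᵥ w.ofLp = 1 := by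
    rw [hwdef, Matrix.mulVec_mulVec, Matrix.mul_nonsing_inv _ hdet, Matrix.one_mulVec]
  have hw0 : w ≠ 0 := by
    intro h
    rw [h, WithLp.ofLp_zero, Matrix.mulVec_zero] at hw
    exact zero_ne_one hw
  have hw' : 0 < ‖w‖ := norm_pos_iff.2 hw0
  have hlam2 : lam = σ ^ 2 * ‖w‖ ^ 2 := by
    rw [hlam, ← hw, hinv, dot_inner, real_inner_self_eq_norm_sq]
  have hl : 0 < lam := by rw [hlam2]; positivity
  have ht := quantile_pos n hn α hα
  set t := tQuantile n (1 - α / 2) with htdef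
  have hH : Homogeneous LGS UGS := gs_homog Sig lam n t hl hlam m hm S hS LGS UGS hLGS hUGS
  have hB : accB A LGS UGS = TT w (‖w‖ * (t / √((n : ℝ) + t ^ 2))) :=
    gs_accB A Sig σ lam n t hσ (by exact_mod_cast hn) ht w hw0 hw hinv hlam2 m hm S hS
      LGS UGS hLGS hUGS
  have hc : 0 < ‖w‖ * (t / √((n : ℝ) + t ^ 2)) := by positivity
  have hT := TT_prob n hn w hw0 α hα
  rw [← htdef] at hT
  refine ⟨fun δ => (stdGaussian (EuclideanSpace ℝ (Fin (n + 1)))).real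
    {x | x - δ • w ∈ accB A LGS UGS}, fun δ => ?_, ?_, fun δ _ => ?_, fun L U hLU hub δ hδ => ?_⟩
  · exact conv_lemma P ψ Y hYmeas A w hw hCLT LGS UGS hH δ
  · simp only [zero_smul, sub_zero, Set.ofPred_mem_eq, hB]
    exact hT
  · simp only [hB]
    exact np_unb w _ hc _ hT δ
  · have hconv := conv_lemma P ψ Y hYmeas A w hw hCLT L U hLU
    rw [(hconv δ).limsup_eq]
    simp only [hB]
    refine np_sets w _ hc _ hT _ (accB_meas A L U hLU) (accB_cone A L U hLU) ?_ ?_ δ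
    · obtain ⟨l, hl1, hl2⟩ := hub.1
      have h0 := hconv 0
      simp only [zero_div, add_zero] at h0
      rw [tendsto_nhds_unique h0 hl2]
      exact hl1
    · intro δ hδ
      rw [← (hconv δ).limsup_eq]
      exact hub.2 δ hδ
end

section
/- Let θ ∈ ℝ, q > 0, α ∈ (0,1), and let (ψ_n)_{n≥1} and (A_n)_{n≥1} be real random variables on a common probability space such that the pair (√n(ψ_n − θ), A_n) converges in distribution on ℝ² to (Z, A), where Z ~ N(0, s²) for some s > 0, A ≥ 0 almost surely, and Z is independent of A. Let C_n = [ψ_n − n^{−1/2}qA_n, ψ_n + n^{−1/2}qA_n], and assume lim_n P(θ ∈ C_n) = 1−α. Then for every δ ∈ ℝ, lim_n P(θ + n^{−1/2}δ ∈ C_n) exists, equals P(δ − qA ≤ Z ≤ δ + qA), and is at most 1−α. In particular, C_n is asymptotically unbiased at level 1−α. -/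
open MeasureTheory ProbabilityTheory Matrix Filter Topology

lemma gauss_pdf_anti (v : NNReal) (x y : ℝ) (h : |x| ≤ |y|) :
    gaussianPDF 0 v y ≤ gaussianPDF 0 v x := by
  unfold gaussianPDF gaussianPDFReal
  apply ENNReal.ofReal_le_ofReal
  have h2 : x ^ 2 ≤ y ^ 2 := sq_le_sq.mpr h
  simp only [sub_zero]
  gcongr

lemma gauss_anderson (v : NNReal) (hv : v ≠ 0) (δ c : ℝ) :
    gaussianReal 0 v (Set.Icc (δ - c) (δ + c)) ≤ gaussianReal 0 v (Set.Icc (0 - c) (0 + c)) := by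
  rcases lt_or_ge c 0 with hc | hc
  · rw [Set.Icc_eq_empty (by linarith)]; simp
  set J := Set.Icc (δ - c) (δ + c) with hJ
  set I := Set.Icc (0 - c) (0 + c) with hI
  have mJ : MeasurableSet J := measurableSet_Icc
  have mI : MeasurableSet I := measurableSet_Icc
  have hvol : volume (J \ I) = volume (I \ J) := by
    have h1 := measure_inter_add_sdiff (μ := volume) J mI
    have h2 := measure_inter_add_sdiff (μ := volume) I mJ
    have h3 : volume J = volume I := by
      simp only [hJ, hI, Real.volume_Icc]; congr 1; ring
    rw [Set.inter_comm I J, ← h3, ← h1] at h2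
    have hfin : volume (J ∩ I) ≠ ⊤ :=
      ne_top_of_le_ne_top (by simp [hJ, Real.volume_Icc]) (measure_mono (Set.inter_subset_left))
    exact ((ENNReal.add_right_inj hfin).1 h2).symm
  have hJI : gaussianReal 0 v (J \ I) ≤ gaussianPDF 0 v c * volume (J \ I) := by
    rw [gaussianReal_apply _ hv, ← setLIntegral_const]
    refine setLIntegral_mono (by fun_prop) fun x hx => gauss_pdf_anti v _ _ ?_
    rw [abs_of_nonneg hc]
    by_contra hlt
    have := abs_lt.1 (not_le.1 hlt)
    exact hx.2 ⟨by linarith [this.1], by linarith [this.2]⟩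
  have hIJ : gaussianPDF 0 v c * volume (I \ J) ≤ gaussianReal 0 v (I \ J) := by
    rw [gaussianReal_apply _ hv, ← setLIntegral_const]
    refine setLIntegral_mono (by fun_prop) fun x hx => gauss_pdf_anti v _ _ ?_
    rw [abs_of_nonneg hc]
    exact abs_le.2 ⟨by linarith [hx.1.1], by linarith [hx.1.2]⟩
  rw [← measure_inter_add_sdiff (μ := gaussianReal 0 v) J mI,
    ← measure_inter_add_sdiff (μ := gaussianReal 0 v) I mJ, Set.inter_comm I J]
  refine add_le_add_right ?_ _
  exact hJI.trans (hvol ▸ hIJ)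

/-- If `(√n(ψₙ − θ), Aₙ)` converges jointly in distribution to `(Z, A)` with
`Z ~ N(0, s²)` independent of `A ≥ 0`, and the interval `Cₙ = ψₙ ± q Aₙ/√n` is asymptotically
exact at level `1 − α`, then for every `δ` the coverage of `θ + δ/√n` converges to
`P(δ − qA ≤ Z ≤ δ + qA)`, which is at most `1 − α`; in particular `Cₙ` is asymptotically
unbiased at level `1 − α`. -/
theorem stmt5 {Ω : Type*} [MeasurableSpace Ω] (P : Measure Ω) [IsProbabilityMeasure P]
    (θ q α : ℝ) (hq : 0 < q) (hα : α ∈ Set.Ioo (0 : ℝ) 1)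
    (ψ A : ℕ → Ω → ℝ) (hψ : ∀ n, Measurable (ψ n)) (hA : ∀ n, Measurable (A n))
    (ν : Measure (ℝ × ℝ)) [IsProbabilityMeasure ν]
    (s : ℝ) (hs : 0 < s)
    -- the first marginal of the limit is N(0, s²)
    (hZ : ν.map Prod.fst = gaussianReal 0 (Real.toNNReal (s ^ 2)))
    -- A ≥ 0 almost surely under the limit
    (hApos : ν {p : ℝ × ℝ | p.2 < 0} = 0)
    -- Z and A are independent: the limit law is the product of its marginals
    (hindep : ν = (ν.map Prod.fst).prod (ν.map Prod.snd))
    -- joint convergence in distribution of `(√n(ψₙ − θ), Aₙ)` to `ν`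
    (hCLT : TendstoInDist P (fun n ω => (Real.sqrt n * (ψ n ω - θ), A n ω)) ν)
    -- asymptotic exactness: lim P(θ ∈ Cₙ) = 1 − α
    (hexact : Tendsto (fun n => (P {ω | ψ n ω - q * A n ω / Real.sqrt n ≤ θ ∧
      θ ≤ ψ n ω + q * A n ω / Real.sqrt n}).toReal) atTop (𝓝 (1 - α))) :
    ∀ δ : ℝ,
      Tendsto (fun n => (P {ω | ψ n ω - q * A n ω / Real.sqrt n ≤ θ + δ / Real.sqrt n ∧
          θ + δ / Real.sqrt n ≤ ψ n ω + q * A n ω / Real.sqrt n}).toReal) atTop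
        (𝓝 ((ν {p : ℝ × ℝ | δ - q * p.2 ≤ p.1 ∧ p.1 ≤ δ + q * p.2}).toReal)) ∧
      (ν {p : ℝ × ℝ | δ - q * p.2 ≤ p.1 ∧ p.1 ≤ δ + q * p.2}).toReal ≤ 1 - α := by
  set v := Real.toNNReal (s ^ 2) with hvdef
  have hv : v ≠ 0 := by
    rw [hvdef]; exact (Real.toNNReal_pos.2 (by positivity)).ne'
  set S : ℝ → Set (ℝ × ℝ) := fun δ => {p : ℝ × ℝ | δ - q * p.2 ≤ p.1 ∧ p.1 ≤ δ + q * p.2} with hS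
  have hSc : ∀ δ, IsClosed (S δ) := by
    intro δ
    have h1 : IsClosed {p : ℝ × ℝ | δ - q * p.2 ≤ p.1} := isClosed_le (by fun_prop) (by fun_prop)
    have h2 : IsClosed {p : ℝ × ℝ | p.1 ≤ δ + q * p.2} := isClosed_le (by fun_prop) (by fun_prop)
    have h3 := h1.inter h2
    convert h3 using 1
    ext p
    simp [hS]
  set ρ := ν.map Prod.snd with hρ
  have : IsProbabilityMeasure ρ := Measure.isProbabilityMeasure_map (by fun_prop)
  have hν : ν = (gaussianReal 0 v).prod ρ := by rw [← hZ]; exact hindep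
  have : NullSingletonClass (gaussianReal 0 v) := nullSingletonClass_gaussianReal hv
  have hle : ∀ δ, ν (S δ) ≤ ν (S 0) := by
    intro δ
    rw [hν, Measure.prod_apply_symm (hSc δ).measurableSet,
      Measure.prod_apply_symm (hSc 0).measurableSet]
    exact lintegral_mono fun a => gauss_anderson v hv δ (q * a)
  have hline : ∀ δ t : ℝ, ν {p : ℝ × ℝ | p.1 = δ + t * p.2} = 0 := by
    intro δ t
    have hc : IsClosed {p : ℝ × ℝ | p.1 = δ + t * p.2} :=
      isClosed_eq (by fun_prop) (by fun_prop)
    rw [hν, Measure.prod_apply_symm hc.measurableSet]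
    have : ∀ a : ℝ, gaussianReal 0 v ((fun x => (x, a)) ⁻¹' {p : ℝ × ℝ | p.1 = δ + t * p.2}) = 0 := by
      intro a
      exact measure_singleton (μ := gaussianReal 0 v) (δ + t * a)
    simp [this]
  have hfr : ∀ δ, ν (frontier (S δ)) = 0 := by
    intro δ
    refine measure_mono_null ?_ (measure_union_null (hline δ (-q)) (hline δ q))
    rintro p hp
    have hpS : p ∈ S δ := (hSc δ).frontier_subset hp
    by_contra hcon
    simp only [Set.mem_union, Set.mem_ofPred_eq, not_or] at hcon
    have hopen : IsOpen {p : ℝ × ℝ | δ - q * p.2 < p.1 ∧ p.1 < δ + q * p.2} := by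
      have h1 : IsOpen {p : ℝ × ℝ | δ - q * p.2 < p.1} := isOpen_lt (by fun_prop) (by fun_prop)
      have h2 : IsOpen {p : ℝ × ℝ | p.1 < δ + q * p.2} := isOpen_lt (by fun_prop) (by fun_prop)
      have h3 := h1.inter h2
      convert h3 using 1
      ext p
      simp [hS]
    have hsub : {p : ℝ × ℝ | δ - q * p.2 < p.1 ∧ p.1 < δ + q * p.2} ⊆ S δ :=
      fun p hp => ⟨hp.1.le, hp.2.le⟩
    refine hp.2 (interior_maximal hsub hopen ⟨lt_of_le_of_ne hpS.1 ?_, lt_of_le_of_ne hpS.2 hcon.2⟩)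
    intro h
    exact hcon.1 (by linarith)
  have hXm : ∀ n : ℕ, Measurable (fun ω => (Real.sqrt n * (ψ n ω - θ), A n ω)) := by
    intro n
    have := hψ n
    have := hA n
    fun_prop
  let μs : ℕ → ProbabilityMeasure (ℝ × ℝ) := fun n =>
    ⟨P.map (fun ω => (Real.sqrt n * (ψ n ω - θ), A n ω)),
      Measure.isProbabilityMeasure_map (hXm n).aemeasurable⟩
  let μ : ProbabilityMeasure (ℝ × ℝ) := ⟨ν, inferInstance⟩
  have hconv : Tendsto μs atTop (𝓝 μ) := by
    rw [ProbabilityMeasure.tendsto_iff_forall_integral_tendsto]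
    intro f
    refine (hCLT f).congr fun n => ?_
    exact (integral_map (hXm n).aemeasurable f.continuous.aestronglyMeasurable).symm
  have hlim : ∀ δ : ℝ,
      Tendsto (fun n : ℕ => (P {ω | ψ n ω - q * A n ω / Real.sqrt n ≤ θ + δ / Real.sqrt n ∧
          θ + δ / Real.sqrt n ≤ ψ n ω + q * A n ω / Real.sqrt n}).toReal) atTop
        (𝓝 ((ν (S δ)).toReal)) := by
    intro δ
    have h := ProbabilityMeasure.tendsto_measure_of_null_frontier_of_tendsto' hconv
      (E := S δ) (hfr δ)
    have h2 := (ENNReal.tendsto_toReal (measure_ne_top ν (S δ))).comp h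
    refine h2.congr' ?_
    filter_upwards [eventually_gt_atTop 0] with n hn
    have hr : 0 < Real.sqrt n := Real.sqrt_pos.2 (by exact_mod_cast hn)
    change (P.map (fun ω => (Real.sqrt n * (ψ n ω - θ), A n ω)) (S δ)).toReal = _
    rw [Measure.map_apply (hXm n) (hSc δ).measurableSet]
    congr 2
    ext ω
    simp only [hS, Set.mem_preimage, Set.mem_ofPred_eq]
    have e1 : ψ n ω - q * A n ω / Real.sqrt n ≤ θ + δ / Real.sqrt n ↔
        Real.sqrt n * (ψ n ω - θ) ≤ δ + q * A n ω := by
      rw [← mul_le_mul_iff_right₀ hr]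
      have a1 : Real.sqrt n * (ψ n ω - q * A n ω / Real.sqrt n) =
        Real.sqrt n * ψ n ω - q * A n ω := by field_simp
      have a2 : Real.sqrt n * (θ + δ / Real.sqrt n) = Real.sqrt n * θ + δ := by field_simp
      rw [a1, a2]
      constructor <;> intro h <;> linarith
    have e2 : θ + δ / Real.sqrt n ≤ ψ n ω + q * A n ω / Real.sqrt n ↔
        δ - q * A n ω ≤ Real.sqrt n * (ψ n ω - θ) := by
      rw [← mul_le_mul_iff_right₀ hr]
      have a1 : Real.sqrt n * (ψ n ω + q * A n ω / Real.sqrt n) =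
        Real.sqrt n * ψ n ω + q * A n ω := by field_simp
      have a2 : Real.sqrt n * (θ + δ / Real.sqrt n) = Real.sqrt n * θ + δ := by field_simp
      rw [a1, a2]
      constructor <;> intro h <;> linarith
    rw [e1, e2, and_comm]
  have h0 : (ν (S 0)).toReal = 1 - α := by
    refine tendsto_nhds_unique (hlim 0) ?_
    simpa using hexact
  intro δ
  refine ⟨hlim δ, ?_⟩
  rw [← h0]
  exact ENNReal.toReal_mono (measure_ne_top _ _) (hle δ)
end

section
/- Let K ≥ 2, let Σ be a K×K positive definite matrix with λ = 1_K^TΣ^{-1}1_K, let σ > 0, and let Z ~ N(0, σ²Σ). Define m(Z) = 1_K^TΣ^{-1}Z/λ and S(Z)² = (1/(λ(K−1)))·(Z − m(Z)1_K)^TΣ^{-1}(Z − m(Z)1_K). Then S(Z) > 0 almost surely, and the pivotal statistic V'(Z) = m(Z)/S(Z) has the Student t distribution with K−1 degrees of freedom, i.e., V'(Z) has the same law as N/√(Q/(K−1)) where N is standard normal independent of Q ~ χ²_{K−1}. -/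
open MeasureTheory ProbabilityTheory Matrix Filter Topology

open Real in
lemma mgf_sumsq (n : ℕ) (t : ℝ) :
    mgf id ((Measure.pi fun _ : Fin n => gaussianReal 0 1).map (fun x => ∑ i, x i ^ 2)) t
      = (√(1 / (1 - 2 * t))) ^ n := by
  rw [mgf_id_map (Measurable.aemeasurable (by fun_prop))]
  unfold mgf
  simp_rw [Finset.mul_sum, Real.exp_sum]
  rw [integral_fintype_prod_eq_pow (fun x : ℝ => Real.exp (t * x ^ 2)), Fintype.card_fin]
  congr 1
  rw [integral_gaussianReal_eq_integral_smul one_ne_zero]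
  have : ∀ x : ℝ, gaussianPDFReal 0 1 x • Real.exp (t * x ^ 2)
      = (√(2 * π))⁻¹ * Real.exp (-(1 / 2 - t) * x ^ 2) := by
    intro x
    simp only [gaussianPDFReal, NNReal.coe_one, mul_one, sub_zero, smul_eq_mul]
    rw [mul_assoc, ← Real.exp_add]
    congr 2
    ring
  simp_rw [this]
  rw [integral_const_mul, integral_gaussian, ← Real.sqrt_inv, ← Real.sqrt_mul (by positivity)]
  congr 1
  rw [show (1 : ℝ) / 2 - t = (1 - 2 * t) / 2 by ring]
  by_cases h : 1 - 2 * t = 0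
  · simp [h]
  · field_simp

open Real in
lemma mgf_gamma (n : ℕ) (hn : 1 ≤ n) (t : ℝ) :
    mgf id (gammaMeasure ((n : ℝ) / 2) (1 / 2)) t = (√(1 / (1 - 2 * t))) ^ n := by
  have hn' : (0 : ℝ) < (n : ℝ) / 2 := by positivity
  have hpdf : ∀ x, (gammaPDF ((n : ℝ) / 2) (1 / 2) x).toReal
      = gammaPDFReal ((n : ℝ) / 2) (1 / 2) x := fun x =>
    ENNReal.toReal_ofReal (gammaPDFReal_nonneg hn' (by norm_num) x)
  have hm : Measurable (gammaPDF ((n : ℝ) / 2) (1 / 2)) :=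
    (measurable_gammaPDFReal _ _).ennreal_ofReal
  unfold mgf gammaMeasure
  rw [integral_withDensity_eq_integral_toReal_smul hm
    (ae_of_all _ fun _ => ENNReal.ofReal_lt_top)]
  simp_rw [hpdf]
  have e1 : (fun x : ℝ => gammaPDFReal ((n : ℝ) / 2) (1 / 2) x • Real.exp (t * id x))
      = (Set.Ici (0 : ℝ)).indicator (fun x => ((1 / 2 : ℝ) ^ ((n : ℝ) / 2) / Gamma ((n : ℝ) / 2)) *
        (x ^ ((n : ℝ) / 2 - 1) * Real.exp (-((1 / 2 - t) * x)))) := by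
    ext x
    by_cases hx : 0 ≤ x
    · rw [Set.indicator_of_mem (by exact hx)]
      simp only [gammaPDFReal, if_pos hx, smul_eq_mul, id]
      rw [mul_assoc, mul_assoc, ← Real.exp_add]
      congr 3
      ring
    · rw [Set.indicator_of_notMem (by exact hx)]
      simp [gammaPDFReal, hx]
  rw [e1, integral_indicator measurableSet_Ici, integral_Ici_eq_integral_Ioi, integral_const_mul]
  by_cases ht : t < 1 / 2
  · rw [integral_rpow_mul_exp_neg_mul_Ioi hn' (by linarith)]
    have hG : Gamma ((n : ℝ) / 2) ≠ 0 := (Gamma_pos_of_pos hn').ne'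
    have h1 : (0 : ℝ) < 1 / (1 / 2 - t) := by apply one_div_pos.2; linarith
    rw [Real.sqrt_eq_rpow, ← Real.rpow_natCast, ← Real.rpow_mul (by apply one_div_nonneg.2; linarith),
      show (1 : ℝ) / 2 * n = n / 2 by ring]
    rw [show (1 : ℝ) / (1 - 2 * t) = (1 / 2) * (1 / (1 / 2 - t)) by
      have : (1 : ℝ) / 2 - t ≠ 0 := by linarith
      have : (1 : ℝ) - 2 * t ≠ 0 := by linarith
      rw [show (1 : ℝ) - 2 * t = 2 * (1 / 2 - t) by ring]
      field_simp,
      Real.mul_rpow (by norm_num) h1.le]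
    field_simp
  · rw [integral_undef, mul_zero, Real.sqrt_eq_zero_of_nonpos, zero_pow (by omega)]
    · apply one_div_nonpos.2; linarith
    · intro hi
      apply not_integrableOn_Ioi_rpow ((n : ℝ) / 2 - 1)
      refine Integrable.mono' hi (by fun_prop) ?_
      refine (ae_restrict_iff' measurableSet_Ioi).2 (ae_of_all _ fun x hx => ?_)
      have hx : (0 : ℝ) < x := hx
      have h0 := (Real.rpow_pos_of_pos hx ((n : ℝ) / 2 - 1))
      rw [Real.norm_of_nonneg h0.le]
      refine le_mul_of_one_le_right h0.le (Real.one_le_exp ?_)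
      nlinarith

lemma map_sumsq (n : ℕ) (hn : 1 ≤ n) :
    (Measure.pi fun _ : Fin n => gaussianReal 0 1).map (fun x => ∑ i, x i ^ 2)
      = gammaMeasure ((n : ℝ) / 2) (1 / 2) := by
  have hn' : (0 : ℝ) < (n : ℝ) / 2 := by positivity
  have : IsProbabilityMeasure (gammaMeasure ((n : ℝ) / 2) (1 / 2)) :=
    isProbabilityMeasure_gammaMeasure hn' (by norm_num)
  have hp : IsProbabilityMeasure
      ((Measure.pi fun _ : Fin n => gaussianReal 0 1).map (fun x => ∑ i, x i ^ 2)) :=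
    Measure.isProbabilityMeasure_map (Measurable.aemeasurable (by fun_prop))
  have hmgf : mgf id ((Measure.pi fun _ : Fin n => gaussianReal 0 1).map (fun x => ∑ i, x i ^ 2))
      = mgf id (gammaMeasure ((n : ℝ) / 2) (1 / 2)) := by
    ext t
    rw [mgf_sumsq, mgf_gamma n hn]
  have hE := eqOn_complexMGF_of_mgf hmgf
  have h0 : (0 : ℝ) ∈ interior (integrableExpSet id
      ((Measure.pi fun _ : Fin n => gaussianReal 0 1).map (fun x => ∑ i, x i ^ 2))) := by
    rw [mem_interior_iff_mem_nhds]
    filter_upwards [Iio_mem_nhds (show (0 : ℝ) < 1 / 2 by norm_num)] with t ht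
    have ht : t < 1 / 2 := ht
    show Integrable _ _
    rw [← mgf_pos_iff, mgf_sumsq]
    have : 0 < 1 / (1 - 2 * t) := by apply one_div_pos.2; linarith
    positivity
  apply Measure.ext_of_charFun
  ext t
  have := hE (x := (t : ℂ) * Complex.I) (by simpa using h0)
  rwa [complexMGF_id_mul_I, complexMGF_id_mul_I] at this

lemma map_rot (n : ℕ) (hn : 1 ≤ n) (v : Fin (n + 1) → ℝ) (hv : v ⬝ᵥ v = 1) :
    (stdGaussianPi (n + 1)).map (fun ξ => (v ⬝ᵥ ξ, ξ ⬝ᵥ ξ - (v ⬝ᵥ ξ) ^ 2))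
      = (gaussianReal 0 1).prod (chiSq n) := by
  obtain ⟨b, hb⟩ := Orthonormal.exists_orthonormalBasis_extension_of_card_eq (𝕜 := ℝ)
    (E := EuclideanSpace ℝ (Fin (n + 1))) (ι := Fin (n + 1)) (by simp)
    (v := fun _ => WithLp.toLp 2 v) (s := {0}) (by
      constructor
      · intro i
        have : ‖WithLp.toLp 2 v‖ ^ 2 = 1 := by
          rw [EuclideanSpace.real_norm_sq_eq, ← hv]
          simp [dotProduct, sq]
        have h2 : ‖WithLp.toLp 2 v‖ = 1 := by
          nlinarith [norm_nonneg (WithLp.toLp 2 v)]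
        simpa using h2
      · intro i j hij
        exact absurd (Subsingleton.elim i j) hij)
  have hb0 : b 0 = WithLp.toLp 2 v := hb 0 rfl
  let R : (Fin (n + 1) → ℝ) → (Fin (n + 1) → ℝ) := fun ξ => WithLp.ofLp (b.repr (WithLp.toLp 2 ξ))
  have hRm : Measurable R := by
    apply Continuous.measurable
    fun_prop
  have hR : (stdGaussianPi (n + 1)).map R = stdGaussianPi (n + 1) := by
    have h1 := map_pi_eq_stdGaussian (ι := Fin (n + 1))
    have h2 := stdGaussian_map b.repr
    have h3 : (stdGaussian (EuclideanSpace ℝ (Fin (n + 1)))).map WithLp.ofLp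
        = stdGaussianPi (n + 1) := by
      rw [← h1, Measure.map_map (by fun_prop) (by fun_prop)]
      exact Measure.map_id
    conv_rhs => rw [← h3, ← h2, ← h1]
    rw [Measure.map_map (by fun_prop) (by fun_prop), Measure.map_map (by fun_prop) (by fun_prop)]
    rfl
  have hR0 : ∀ ξ, R ξ 0 = v ⬝ᵥ ξ := by
    intro ξ
    simp only [R, OrthonormalBasis.repr_apply_apply, hb0]
    simp [PiLp.inner_apply, dotProduct, mul_comm]
  have hRn : ∀ ξ, ∑ i, R ξ i ^ 2 = ξ ⬝ᵥ ξ := by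
    intro ξ
    have : ‖b.repr (WithLp.toLp 2 ξ)‖ ^ 2 = ‖WithLp.toLp 2 ξ‖ ^ 2 := by
      rw [LinearIsometryEquiv.norm_map]
    rw [EuclideanSpace.real_norm_sq_eq, EuclideanSpace.real_norm_sq_eq] at this
    simpa [R, dotProduct, sq] using this
  have hfun : (fun ξ : Fin (n + 1) → ℝ => (v ⬝ᵥ ξ, ξ ⬝ᵥ ξ - (v ⬝ᵥ ξ) ^ 2))
      = (fun η : Fin (n + 1) → ℝ => (η 0, ∑ i : Fin n, η i.succ ^ 2)) ∘ R := by
    ext ξ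
    · simp [hR0]
    · simp only [Function.comp]
      rw [← hRn, ← hR0, Fin.sum_univ_succ]
      ring
  rw [hfun, ← Measure.map_map (by fun_prop) hRm, hR]
  have hp := measurePreserving_piFinSuccAbove (fun _ : Fin (n + 1) => gaussianReal 0 1) 0
  have hfun2 : (fun η : Fin (n + 1) → ℝ => (η 0, ∑ i : Fin n, η i.succ ^ 2))
      = (Prod.map id (fun x : Fin n → ℝ => ∑ i, x i ^ 2)) ∘
        (MeasurableEquiv.piFinSuccAbove (fun _ : Fin (n + 1) => ℝ) 0) := by
    ext η
    · simp [MeasurableEquiv.piFinSuccAbove]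
    · simp [MeasurableEquiv.piFinSuccAbove, Fin.tail]
  rw [hfun2, ← Measure.map_map (by fun_prop) (MeasurableEquiv.measurable _), stdGaussianPi, hp.map_eq,
    ← Measure.map_prod_map _ _ measurable_id (by fun_prop), Measure.map_id, map_sumsq n hn, chiSq]

/-- For `Z ~ N(0, σ²Σ)`, the variance estimator `S(Z)²` is a.s. positive and
the pivotal statistic `V'(Z) = m(Z)/S(Z)` has the Student t distribution with `K−1` degrees of
freedom. -/
theorem stmt8 (K : ℕ) (hK : 2 ≤ K) (Sig : Matrix (Fin K) (Fin K) ℝ) (hSig : Sig.PosDef)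
    (lam : ℝ) (hlam : lam = (1 : Fin K → ℝ) ⬝ᵥ Sig⁻¹.mulVec 1)
    (σ : ℝ) (hσ : 0 < σ)
    (μZ : Measure (Fin K → ℝ)) (hGauss : IsGaussianVec μZ 0 (σ ^ 2 • Sig))
    (m : (Fin K → ℝ) → ℝ) (hm : ∀ z, m z = ((1 : Fin K → ℝ) ⬝ᵥ Sig⁻¹.mulVec z) / lam)
    (Ssq : (Fin K → ℝ) → ℝ)
    (hSsq : ∀ z, Ssq z = (1 / (lam * ((K : ℝ) - 1))) *
      ((z - m z • 1) ⬝ᵥ Sig⁻¹.mulVec (z - m z • 1))) :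
    μZ {z | Ssq z ≤ 0} = 0 ∧
    μZ.map (fun z => m z / Real.sqrt (Ssq z)) = studentT ((K : ℝ) - 1) := by
  obtain ⟨A, hA, hμ⟩ := hGauss
  obtain ⟨n, rfl⟩ : ∃ n, K = n + 1 := ⟨K - 1, by omega⟩
  have hn : 1 ≤ n := by omega
  have hn0 : (0 : ℝ) < n := by exact_mod_cast hn
  have hcast : (((n + 1 : ℕ) : ℝ) - 1) = n := by push_cast; ring
  simp only [hcast] at hSsq
  rw [hcast]
  have hdet : IsUnit A.det := by
    have h1 : (σ ^ 2 • Sig).det = A.det * A.det := by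
      rw [hA, Matrix.det_mul, Matrix.det_transpose]
    rw [Matrix.det_smul] at h1
    have h2 := hSig.det_pos
    rw [isUnit_iff_ne_zero]
    intro h0
    rw [h0, mul_zero] at h1
    have : 0 < (σ ^ 2) ^ Fintype.card (Fin (n + 1)) * Sig.det := by positivity
    linarith
  have hBA : A⁻¹ * A = 1 := Matrix.nonsing_inv_mul A hdet
  have hinv : Sig⁻¹ = σ ^ 2 • ((A⁻¹)ᵀ * A⁻¹) := by
    apply Matrix.inv_eq_left_inv
    rw [Matrix.smul_mul, ← Matrix.mul_smul, hA, Matrix.mul_assoc, ← Matrix.mul_assoc (A⁻¹) A, hBA,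
      Matrix.one_mul, ← Matrix.transpose_mul, Matrix.mul_nonsing_inv A hdet, Matrix.transpose_one]
  have hform : ∀ x y : Fin (n + 1) → ℝ, x ⬝ᵥ Sig⁻¹.mulVec y
      = σ ^ 2 * (A⁻¹.mulVec x ⬝ᵥ A⁻¹.mulVec y) := by
    intro x y
    rw [hinv, Matrix.smul_mulVec, dotProduct_smul, smul_eq_mul, ← Matrix.mulVec_mulVec,
      Matrix.dotProduct_mulVec, Matrix.vecMul_transpose]
  have hBz : ∀ ξ : Fin (n + 1) → ℝ, A⁻¹.mulVec (A.mulVec ξ) = ξ := by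
    intro ξ
    rw [Matrix.mulVec_mulVec, hBA, Matrix.one_mulVec]
  obtain ⟨u, hu⟩ : ∃ u, u = A⁻¹.mulVec (1 : Fin (n + 1) → ℝ) := ⟨_, rfl⟩
  obtain ⟨w, hw⟩ : ∃ w, w = u ⬝ᵥ u := ⟨_, rfl⟩
  have hlw : lam = σ ^ 2 * w := by rw [hlam, hform, ← hu, ← hw]
  have hw0 : 0 < w := by
    have h1 : 0 ≤ w := by
      rw [hw]; exact Finset.sum_nonneg fun i _ => mul_self_nonneg _
    refine lt_of_le_of_ne h1 fun h => ?_
    rw [hw] at h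
    have hu0 : u = 0 := dotProduct_self_eq_zero.1 h.symm
    have h2 : A.mulVec u = 1 := by
      rw [hu, Matrix.mulVec_mulVec, Matrix.mul_nonsing_inv A hdet, Matrix.one_mulVec]
    rw [hu0, Matrix.mulVec_zero] at h2
    have := congrFun h2 0
    simp at this
  have hsw : 0 < √w := Real.sqrt_pos.2 hw0
  have hsq : √w * √w = w := Real.mul_self_sqrt hw0.le
  obtain ⟨v, hv⟩ : ∃ v, v = (√w)⁻¹ • u := ⟨_, rfl⟩
  have hvu : ∀ ξ, u ⬝ᵥ ξ = √w * (v ⬝ᵥ ξ) := by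
    intro ξ
    rw [hv, smul_dotProduct, smul_eq_mul]
    field_simp
  have hvv : v ⬝ᵥ v = 1 := by
    rw [hv, smul_dotProduct, dotProduct_smul, ← hw, smul_eq_mul, smul_eq_mul]
    field_simp
    rw [sq, hsq]
  have hmA : ∀ ξ, m (A.mulVec ξ) = (v ⬝ᵥ ξ) / √w := by
    intro ξ
    rw [hm, hform, hBz, ← hu, hlw, hvu]
    nth_rewrite 2 [← hsq]
    field_simp
  have hSA : ∀ ξ, Ssq (A.mulVec ξ) = (1 / w) * ((ξ ⬝ᵥ ξ - (v ⬝ᵥ ξ) ^ 2) / n) := by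
    intro ξ
    rw [hSsq, hform, Matrix.mulVec_sub, Matrix.mulVec_smul, hBz, ← hu, hmA, hlw]
    simp only [sub_dotProduct, dotProduct_sub, smul_dotProduct, dotProduct_smul, smul_eq_mul]
    rw [dotProduct_comm ξ u, ← hw, hvu]
    generalize √w = s at hsw hsq
    generalize v ⬝ᵥ ξ = a
    generalize ξ ⬝ᵥ ξ = b
    rw [← hsq]
    field_simp
    ring
  have hrot := map_rot n hn v hvv
  have hAm : Measurable (fun ξ : Fin (n + 1) → ℝ => 0 + A.mulVec ξ) := by
    apply Continuous.measurable
    fun_prop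
  have hmm : Measurable m := by
    rw [show m = _ from funext hm]
    apply Continuous.measurable
    fun_prop
  have hSm : Measurable Ssq := by
    rw [show Ssq = _ from funext hSsq]
    apply Measurable.const_mul
    have : Continuous fun p : (Fin (n + 1) → ℝ) => p ⬝ᵥ Sig⁻¹.mulVec p := by fun_prop
    refine this.measurable.comp ?_
    fun_prop
  have hpm : Measurable (fun ξ : Fin (n + 1) → ℝ => (v ⬝ᵥ ξ, ξ ⬝ᵥ ξ - (v ⬝ᵥ ξ) ^ 2)) := by
    apply Continuous.measurable
    fun_prop
  have hchi : IsProbabilityMeasure (chiSq (n : ℝ)) :=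
    isProbabilityMeasure_gammaMeasure (by positivity) (by norm_num)
  constructor
  · rw [hμ, Measure.map_apply hAm (measurableSet_le hSm measurable_const)]
    have hset : (fun ξ : Fin (n + 1) → ℝ => 0 + A.mulVec ξ) ⁻¹' {z | Ssq z ≤ 0}
        = (fun ξ : Fin (n + 1) → ℝ => (v ⬝ᵥ ξ, ξ ⬝ᵥ ξ - (v ⬝ᵥ ξ) ^ 2)) ⁻¹'
          (Set.univ ×ˢ Set.Iic 0) := by
      ext ξ
      simp only [Set.mem_preimage, Set.mem_ofPred_eq, zero_add, hSA, Set.mem_prod, Set.mem_univ,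
        true_and, Set.mem_Iic]
      rw [show 1 / w * ((ξ ⬝ᵥ ξ - (v ⬝ᵥ ξ) ^ 2) / n)
        = (1 / w / n) * (ξ ⬝ᵥ ξ - (v ⬝ᵥ ξ) ^ 2) by ring]
      have : 0 < 1 / w / n := by positivity
      constructor
      · intro h
        by_contra h'
        push Not at h'
        have := mul_pos this h'
        linarith
      · intro h
        exact mul_nonpos_of_nonneg_of_nonpos this.le h
    rw [hset, ← Measure.map_apply hpm (MeasurableSet.univ.prod measurableSet_Iic), hrot,
      Measure.prod_prod, chiSq, gammaMeasure, withDensity_apply _ measurableSet_Iic,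
      setLIntegral_congr Iio_ae_eq_Iic.symm, lintegral_gammaPDF_of_nonpos le_rfl, mul_zero]
  · have hdm : Measurable (fun p : ℝ × ℝ => p.1 / √(p.2 / n)) := by fun_prop
    rw [hμ, studentT, ← hrot, Measure.map_map (by fun_prop) hAm, Measure.map_map hdm hpm]
    congr 1
    ext ξ
    simp only [Function.comp, zero_add, hSA, hmA]
    rw [Real.sqrt_mul (by positivity), Real.sqrt_div zero_le_one, Real.sqrt_one]
    generalize √((ξ ⬝ᵥ ξ - (v ⬝ᵥ ξ) ^ 2) / n) = q
    rw [div_div, ← mul_assoc, mul_one_div_cancel hsw.ne', one_mul]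
end

section
/- Let K ≥ 2, let Σ be a K×K positive definite matrix with λ = 1_K^TΣ^{-1}1_K, let μ ∈ ℝ and σ > 0, and let Z ~ N(μ1_K, σ²Σ). Define m(Z) = 1_K^TΣ^{-1}Z/λ. Then the random variable W = (1/σ²)·(Z − m(Z)1_K)^TΣ^{-1}(Z − m(Z)1_K) has the chi-squared distribution with K−1 degrees of freedom. -/
open MeasureTheory ProbabilityTheory Matrix Filter Topology

lemma aux_gauss (t : ℝ) : ∫ x, Real.exp (t * x ^ 2) ∂(gaussianReal 0 1) =
    Real.sqrt ((1/2) * (1 / (1/2 - t))) := by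
  rw [integral_gaussianReal_eq_integral_smul one_ne_zero]
  have : ∀ x : ℝ, gaussianPDFReal 0 1 x • Real.exp (t * x ^ 2) =
      (√(2 * Real.pi))⁻¹ * Real.exp (-(1/2 - t) * x ^ 2) := by
    intro x
    rw [gaussianPDFReal, smul_eq_mul, mul_assoc, ← Real.exp_add]
    simp only [NNReal.coe_one, mul_one, sub_zero]
    congr 2
    ring
  simp_rw [this]
  rw [integral_const_mul, integral_gaussian, ← Real.sqrt_inv, ← Real.sqrt_mul (by positivity)]
  congr 1
  have := Real.pi_ne_zero
  field_simp

lemma aux_gamma_integrand (a t x : ℝ) (f : ℝ → ℝ)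
    (hf : f = fun x => x ^ (a - 1) * Real.exp (-((1/2 - t) * x))) :
    (Set.Ici (0:ℝ)).indicator (fun x => (1/2 : ℝ) ^ a / Real.Gamma a * f x) x
      = gammaPDFReal a (1/2) x * Real.exp (t * x) := by
  by_cases hx : 0 ≤ x
  · rw [Set.indicator_of_mem (by exact hx), gammaPDFReal, if_pos hx, hf]
    simp only
    rw [show -((1/2 - t) * x) = -(1/2 * x) + t * x by ring, Real.exp_add]
    ring
  · rw [Set.indicator_of_notMem (by exact hx), gammaPDFReal, if_neg hx, zero_mul]

lemma aux_gamma (a t : ℝ) (ha : 0 < a) :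
    ∫ x, Real.exp (t * x) ∂(gammaMeasure a (1/2)) =
      if t < 1/2 then ((1/2) * (1 / (1/2 - t))) ^ a else 0 := by
  have hG : 0 < Real.Gamma a := Real.Gamma_pos_of_pos ha
  rw [gammaMeasure, integral_withDensity_eq_integral_toReal_smul]
  rotate_left
  · exact (measurable_gammaPDFReal _ _).ennreal_ofReal
  · exact ae_of_all _ fun x => ENNReal.ofReal_lt_top
  have : ∀ x : ℝ, (gammaPDF a (1/2) x).toReal • Real.exp (t * x) =
      (Set.Ici (0:ℝ)).indicator (fun x => (1/2 : ℝ) ^ a / Real.Gamma a *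
        (fun x : ℝ => x ^ (a - 1) * Real.exp (-((1/2 - t) * x))) x) x := by
    intro x
    rw [aux_gamma_integrand a t x _ rfl, gammaPDF,
      ENNReal.toReal_ofReal (gammaPDFReal_nonneg ha (by norm_num) x), smul_eq_mul]
  simp_rw [this]
  rw [integral_indicator measurableSet_Ici, integral_Ici_eq_integral_Ioi, integral_const_mul]
  split_ifs with ht
  · rw [Real.integral_rpow_mul_exp_neg_mul_Ioi ha (by linarith),
      Real.mul_rpow (by norm_num) (by have : 0 < 1/2 - t := by linarith
                                      positivity)]
    field_simp
  · rw [integral_undef, mul_zero]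
    intro h
    apply not_integrableOn_Ioi_rpow (a - 1)
    refine Integrable.mono' h (by fun_prop) ?_
    refine (ae_restrict_iff' measurableSet_Ioi).2 (ae_of_all _ fun x hx => ?_)
    have hx : 0 < x := hx
    rw [Real.norm_of_nonneg (by positivity)]
    refine le_mul_of_one_le_right (by positivity) (Real.one_le_exp ?_)
    nlinarith

lemma aux_sum (K : ℕ) (hK : 2 ≤ K) (i0 : Fin K) :
    (stdGaussianPi K).map (fun x => (∑ i, x i ^ 2) - x i0 ^ 2) = chiSq ((K : ℝ) - 1) := by
  have hK' : (2 : ℝ) ≤ K := by exact_mod_cast hK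
  have ha : (0:ℝ) < (K - 1) / 2 := by linarith
  have : IsProbabilityMeasure (stdGaussianPi K) := by unfold stdGaussianPi; infer_instance
  have hP : IsProbabilityMeasure (chiSq ((K : ℝ) - 1)) :=
    isProbabilityMeasure_gammaMeasure ha (by norm_num)
  have hmeas : Measurable (fun x : Fin K → ℝ => (∑ i, x i ^ 2) - x i0 ^ 2) := by fun_prop
  have hmg : mgf id (chiSq ((K : ℝ) - 1)) =
      mgf (fun x : Fin K → ℝ => (∑ i, x i ^ 2) - x i0 ^ 2) (stdGaussianPi K) := by
    ext t
    have e1 : ∀ x : Fin K → ℝ, Real.exp (t * ((∑ i, x i ^ 2) - x i0 ^ 2)) =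
        ∏ i, (fun i y => if i = i0 then 1 else Real.exp (t * y ^ 2)) i (x i) := by
      intro x
      rw [← Finset.add_sum_erase _ _ (Finset.mem_univ i0), ← Finset.mul_prod_erase _ _ (Finset.mem_univ i0)]
      simp only [if_true, one_mul, add_sub_cancel_left]
      rw [Finset.mul_sum, Real.exp_sum]
      refine Finset.prod_congr rfl fun i hi => ?_
      rw [if_neg (Finset.ne_of_mem_erase hi)]
    simp only [mgf, id]
    simp_rw [e1]
    rw [stdGaussianPi, integral_fintype_prod_eq_prod
      (fun (i : Fin K) (y : ℝ) => if i = i0 then (1:ℝ) else Real.exp (t * y ^ 2)),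
      ← Finset.mul_prod_erase _ _ (Finset.mem_univ i0)]
    rw [Finset.prod_congr rfl (g := fun _ => Real.sqrt ((1/2) * (1 / (1/2 - t))))
      (fun i hi => by simp only [if_neg (Finset.ne_of_mem_erase hi)]; exact aux_gauss t)]
    rw [chiSq, aux_gamma _ _ ha]
    simp only [if_true, integral_const, Finset.prod_const, Finset.card_erase_of_mem (Finset.mem_univ i0),
      Finset.card_univ, Fintype.card_fin, probReal_univ, one_smul, one_mul]
    split_ifs with ht
    · have h2 : 0 < 1/2 - t := by linarith
      rw [Real.sqrt_eq_rpow, ← Real.rpow_natCast, ← Real.rpow_mul (by positivity)]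
      congr 1
      rw [Nat.cast_sub (by omega)]
      push_cast; ring
    · rw [Real.sqrt_eq_zero_of_nonpos, zero_pow (by omega)]
      have : 1 / (1/2 - t) ≤ 0 := one_div_nonpos.2 (by linarith)
      linarith
  have hEq := eqOn_complexMGF_of_mgf hmg
  have hzero_mem : (0:ℝ) ∈ interior (integrableExpSet id (chiSq ((K : ℝ) - 1))) := by
    refine mem_interior.2 ⟨Set.Iio (1/2), ?_, isOpen_Iio, by norm_num⟩
    intro t ht
    have ht : t < 1/2 := ht
    refine not_imp_comm.1 integral_undef ?_
    have := aux_gamma _ t ha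
    rw [if_pos ht] at this
    simp only [id, chiSq]
    rw [this]
    have : 0 < 1/2 - t := by linarith
    positivity
  have := Measure.isProbabilityMeasure_map (μ := stdGaussianPi K) hmeas.aemeasurable
  refine (Measure.ext_of_charFun ?_).symm
  ext t
  have h := hEq (x := (t : ℂ) * Complex.I) (by simpa using hzero_mem)
  rw [complexMGF_mul_I measurable_id.aemeasurable, complexMGF_mul_I hmeas.aemeasurable, Measure.map_id] at h
  exact h

lemma aux_rot (K : ℕ) (hK : 2 ≤ K) (u : Fin K → ℝ) (hu : 0 < u ⬝ᵥ u) :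
    (stdGaussianPi K).map (fun x => x ⬝ᵥ x - (u ⬝ᵥ x) ^ 2 / (u ⬝ᵥ u)) = chiSq ((K : ℝ) - 1) := by
  let E := EuclideanSpace ℝ (Fin K)
  let U : E := WithLp.toLp 2 u
  have hin : ∀ x y : Fin K → ℝ, inner ℝ (WithLp.toLp 2 x : E) (WithLp.toLp 2 y) = x ⬝ᵥ y := by
    intro x y
    rw [EuclideanSpace.inner_eq_star_dotProduct, dotProduct_comm]; simp
  have hUn : ‖U‖ ^ 2 = u ⬝ᵥ u := by rw [← real_inner_self_eq_norm_sq]; exact hin u u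
  have hU0 : ‖U‖ ≠ 0 := by intro h; rw [h] at hUn; norm_num at hUn; linarith
  let i0 : Fin K := ⟨0, by omega⟩
  obtain ⟨b, hb⟩ := Orthonormal.exists_orthonormalBasis_extension_of_card_eq (𝕜 := ℝ) (E := E)
    (ι := Fin K) (by simp [E]) (v := fun _ => (‖U‖⁻¹ : ℝ) • U) (s := {i0}) (by
      refine ⟨fun i => ?_, fun i j hij => (hij (Subsingleton.elim i j)).elim⟩
      simp only [Set.domRestrict, norm_smul, norm_inv]
      rw [Real.norm_of_nonneg (norm_nonneg U)]
      exact inv_mul_cancel₀ hU0)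
  have hb := hb i0 rfl
  let F : E → ℝ := fun x => ‖x‖ ^ 2 - (inner ℝ (b i0) x) ^ 2
  have hF : Measurable F := by fun_prop
  have h1 : (fun x => x ⬝ᵥ x - (u ⬝ᵥ x) ^ 2 / (u ⬝ᵥ u)) = F ∘ (WithLp.toLp 2) := by
    ext x
    simp only [F, Function.comp, hb, inner_smul_left]
    rw [← real_inner_self_eq_norm_sq, hin, hin, ← hUn]
    simp only [conj_trivial]
    field_simp
  have h2 : F ∘ (fun x : Fin K → ℝ => ∑ i, x i • b i) = fun x => (∑ i, x i ^ 2) - x i0 ^ 2 := by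
    ext x
    have : ∀ i, inner ℝ (b i) (∑ j, x j • b j) = x i := fun i => by
      simpa using b.orthonormal.inner_right_fintype x i
    simp only [F, Function.comp]
    rw [this, ← b.sum_sq_norm_inner_right]
    simp_rw [this]
    simp
  rw [h1, ← Measure.map_map hF (by fun_prop), stdGaussianPi, map_pi_eq_stdGaussian,
    stdGaussian_eq_map_pi_orthonormalBasis b, Measure.map_map hF (by fun_prop), h2]
  exact aux_sum K hK i0

/-- For `Z ~ N(μ1_K, σ²Σ)`, the quadratic form
`W = σ⁻²(Z − m(Z)1)ᵀΣ⁻¹(Z − m(Z)1)` is chi-squared with `K−1` degrees of freedom. -/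
theorem stmt9 (K : ℕ) (hK : 2 ≤ K) (Sig : Matrix (Fin K) (Fin K) ℝ) (hSig : Sig.PosDef)
    (lam : ℝ) (hlam : lam = (1 : Fin K → ℝ) ⬝ᵥ Sig⁻¹.mulVec 1)
    (μ σ : ℝ) (hσ : 0 < σ)
    (μZ : Measure (Fin K → ℝ)) (hGauss : IsGaussianVec μZ (μ • 1) (σ ^ 2 • Sig))
    (m : (Fin K → ℝ) → ℝ) (hm : ∀ z, m z = ((1 : Fin K → ℝ) ⬝ᵥ Sig⁻¹.mulVec z) / lam) :
    μZ.map (fun z => (1 / σ ^ 2) *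
      ((z - m z • 1) ⬝ᵥ Sig⁻¹.mulVec (z - m z • 1))) = chiSq ((K : ℝ) - 1) := by
  obtain ⟨A, hA, rfl⟩ := hGauss
  have hσ2 : σ ^ 2 ≠ 0 := by positivity
  have hdet : IsUnit (A * Aᵀ).det := by
    rw [← hA, det_smul]
    exact (mul_ne_zero (pow_ne_zero _ hσ2) hSig.det_pos.ne').isUnit
  have hAd : IsUnit A.det := by
    rw [det_mul] at hdet
    exact isUnit_of_mul_isUnit_left hdet
  have hSi : Sig⁻¹ = σ ^ 2 • (A⁻¹ᵀ * A⁻¹) := by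
    have : Sig = (σ ^ 2)⁻¹ • (A * Aᵀ) := by rw [← hA, smul_smul, inv_mul_cancel₀ hσ2, one_smul]
    refine inv_eq_right_inv ?_
    rw [this, smul_mul_smul_comm, inv_mul_cancel₀ hσ2, one_smul, transpose_nonsing_inv, mul_assoc,
      ← mul_assoc Aᵀ, mul_nonsing_inv _ (by rwa [det_transpose]), one_mul, mul_nonsing_inv _ hAd]
  have hq : ∀ x y : Fin K → ℝ, x ⬝ᵥ Sig⁻¹ *ᵥ y = σ ^ 2 * ((A⁻¹ *ᵥ x) ⬝ᵥ (A⁻¹ *ᵥ y)) := by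
    intro x y
    rw [hSi, smul_mulVec, dotProduct_smul, ← mulVec_mulVec, dotProduct_mulVec, vecMul_transpose,
      smul_eq_mul]
  set u : Fin K → ℝ := A⁻¹ *ᵥ 1 with hu
  have hu0 : 0 < u ⬝ᵥ u := by
    have h1 : (1 : Fin K → ℝ) ≠ 0 := fun h => by
      have := congrFun h ⟨0, by omega⟩
      simp at this
    have hne : u ≠ 0 := fun h => h1 (by
      have : A *ᵥ u = 1 := by rw [hu, mulVec_mulVec, mul_nonsing_inv _ hAd, one_mulVec]
      rw [← this, h, mulVec_zero])
    exact lt_of_le_of_ne (Finset.sum_nonneg fun i _ => mul_self_nonneg (u i))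
      (fun h => hne (dotProduct_self_eq_zero.1 h.symm))
  have hm' : m = fun z => (u ⬝ᵥ (A⁻¹ *ᵥ z)) / (u ⬝ᵥ u) := by
    ext z
    rw [hm, hlam, hq, hq, mul_div_mul_left _ _ hσ2]
  rw [Measure.map_map]
  rotate_left
  · simp only [hm', dotProduct, mulVec]
    fun_prop
  · refine measurable_pi_iff.2 fun i => ?_
    simp only [mulVec, dotProduct, Pi.add_apply]
    fun_prop
  rw [← aux_rot K hK u hu0]
  congr 1
  ext x
  have hAx : A⁻¹ *ᵥ (μ • 1 + A *ᵥ x) = μ • u + x := by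
    rw [mulVec_add, mulVec_smul, mulVec_mulVec, nonsing_inv_mul _ hAd, one_mulVec]
  simp only [Function.comp]
  rw [hq, mulVec_sub, mulVec_smul, ← hu, hm']
  simp only [hAx]
  simp only [dotProduct_add, dotProduct_sub, add_dotProduct, sub_dotProduct, dotProduct_smul,
    smul_dotProduct, smul_eq_mul, dotProduct_comm x u]
  field_simp
  ring
end

section
/- Let K ≥ 1, let Σ be a K×K positive definite matrix, let μ ∈ ℝ and σ > 0, and let Z ~ N(μ1_K, σ²Σ). Let f : ℝ^K → ℝ be a measurable function satisfying f(z − c1_K) = f(z) for all z ∈ ℝ^K and all c ∈ ℝ. Then the random variables 1_K^TΣ^{-1}Z and f(Z) are independent. -/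
open MeasureTheory ProbabilityTheory Matrix Filter Topology

lemma indepFun_map_iff_aux {α β : Type*} [MeasurableSpace α] [MeasurableSpace β]
    {P : Measure α} {h : α → β} (hh : Measurable h) {g f : β → ℝ} (hg : Measurable g)
    (hf : Measurable f) :
    IndepFun g f (P.map h) ↔ IndepFun (fun a => g (h a)) (fun a => f (h a)) P := by
  simp only [indepFun_iff_measure_inter_preimage_eq_mul]
  refine forall_congr' fun s => forall_congr' fun t => forall_congr' fun hs =>
    forall_congr' fun ht => ?_
  rw [Measure.map_apply hh ((hg hs).inter (hf ht)), Measure.map_apply hh (hg hs),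
    Measure.map_apply hh (hf ht)]
  rfl

lemma cov_linear_stdGaussianPi {K : ℕ} (u v : Fin K → ℝ) :
    cov[fun ξ : Fin K → ℝ => u ⬝ᵥ ξ, fun ξ => v ⬝ᵥ ξ; stdGaussianPi K] = u ⬝ᵥ v := by
  have hind : iIndepFun (fun (i : Fin K) (ξ : Fin K → ℝ) => ξ i) (stdGaussianPi K) :=
    iIndepFun_pi (X := fun _ : Fin K => (id : ℝ → ℝ)) (fun _ => aemeasurable_id)
  have : IsProbabilityMeasure (stdGaussianPi K) := hind.isProbabilityMeasure
  have hlp : ∀ i : Fin K, MemLp (fun ξ : Fin K → ℝ => ξ i) 2 (stdGaussianPi K) := fun i =>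
    (memLp_id_gaussianReal (μ := 0) (v := 1) 2).comp_measurePreserving
      (measurePreserving_eval (fun _ : Fin K => gaussianReal 0 1) i)
  have hvar : ∀ i : Fin K, Var[fun ξ : Fin K → ℝ => ξ i; stdGaussianPi K] = 1 := fun i => by
    have h1 := (measurePreserving_eval (fun _ : Fin K => gaussianReal 0 1) i).variance_fun_comp
      (f := fun x => x) (by fun_prop)
    have h2 := variance_fun_id_gaussianReal (μ := 0) (v := 1)
    rw [h2] at h1
    simpa [stdGaussianPi] using h1
  simp only [dotProduct]
  rw [covariance_fun_sum_fun_sum (fun i => (hlp i).const_mul _) (fun i => (hlp i).const_mul _)]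
  refine Finset.sum_congr rfl fun i _ => ?_
  rw [Finset.sum_eq_single i]
  · rw [covariance_const_mul_left, covariance_const_mul_right, covariance_self
      (hlp i).aestronglyMeasurable.aemeasurable, hvar]
    ring
  · intro j _ hj
    rw [covariance_const_mul_left, covariance_const_mul_right,
      (hind.indepFun hj.symm).covariance_eq_zero (hlp i) (hlp j)]
    ring
  · simp

lemma gaussianLaw_stdGaussianPi (K : ℕ) :
    HasGaussianLaw (fun ξ : Fin K → ℝ => ξ) (stdGaussianPi K) := by
  refine iIndepFun.hasGaussianLaw (X := fun (i : Fin K) (ξ : Fin K → ℝ) => ξ i) (fun i => ?_)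
    (iIndepFun_pi (X := fun _ : Fin K => (id : ℝ → ℝ)) (fun _ => aemeasurable_id))
  refine ⟨?_⟩
  have := (measurePreserving_eval (fun _ : Fin K => gaussianReal 0 1) i).map_eq
  have h2 : (stdGaussianPi K).map (fun ξ => ξ i) = gaussianReal 0 1 := this
  rw [h2]
  infer_instance

/-- For `Z ~ N(μ1_K, σ²Σ)` and any measurable `f` invariant under translations
along the all-ones direction, `1ᵀΣ⁻¹Z` and `f(Z)` are independent. -/
theorem stmt10 (K : ℕ) (hK : 1 ≤ K) (Sig : Matrix (Fin K) (Fin K) ℝ) (hSig : Sig.PosDef)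
    (μ σ : ℝ) (hσ : 0 < σ)
    {Ω : Type*} [MeasurableSpace Ω] (Pr : Measure Ω) [IsProbabilityMeasure Pr]
    (Z : Ω → Fin K → ℝ) (hZmeas : Measurable Z)
    (hGauss : IsGaussianVec (Pr.map Z) (μ • 1) (σ ^ 2 • Sig))
    (f : (Fin K → ℝ) → ℝ) (hfmeas : Measurable f)
    (hf : ∀ z : Fin K → ℝ, ∀ c : ℝ, f (z - c • 1) = f z) :
    ProbabilityTheory.IndepFun (fun ω => (1 : Fin K → ℝ) ⬝ᵥ Sig⁻¹.mulVec (Z ω))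
      (fun ω => f (Z ω)) Pr := by
  obtain ⟨A, hA, hlaw⟩ := hGauss
  have hK0 : 0 < K := hK
  set i0 : Fin K := ⟨0, hK0⟩
  set b : Fin K → ℝ := Aᵀ *ᵥ (Sig⁻¹ *ᵥ 1) with hb
  have hSigT : Sig⁻¹ᵀ = Sig⁻¹ := by
    have := hSig.isHermitian.inv
    simpa [Matrix.IsHermitian, Matrix.conjTranspose_eq_transpose_of_trivial] using this
  have hAb : A *ᵥ b = (σ ^ 2) • (1 : Fin K → ℝ) := by
    rw [hb, mulVec_mulVec, ← hA, mulVec_mulVec, smul_mul,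
      mul_nonsing_inv _ ((Matrix.isUnit_iff_isUnit_det _).1 hSig.isUnit), smul_mulVec, one_mulVec]
  -- independence of the linear forms
  have hind : IndepFun (fun (ξ : Fin K → ℝ) (_ : Unit) => b ⬝ᵥ ξ)
      (fun ξ (i : Fin K) => (A i - A i0) ⬝ᵥ ξ) (stdGaussianPi K) := by
    refine HasGaussianLaw.indepFun_of_covariance_eval
      (X := fun (_ : Unit) (ξ : Fin K → ℝ) => b ⬝ᵥ ξ)
      (Y := fun (i : Fin K) (ξ : Fin K → ℝ) => (A i - A i0) ⬝ᵥ ξ) ?_ ?_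
    · let L : (Fin K → ℝ) →ₗ[ℝ] (Unit → ℝ) × (Fin K → ℝ) :=
        { toFun := fun ξ => (fun _ => b ⬝ᵥ ξ, fun i => (A i - A i0) ⬝ᵥ ξ)
          map_add' := fun x y => by ext <;> simp [dotProduct_add]
          map_smul' := fun c y => by ext <;> simp [dotProduct_smul] }
      exact (gaussianLaw_stdGaussianPi K).map_fun (LinearMap.toContinuousLinearMap L)
    · intro _ i
      rw [cov_linear_stdGaussianPi, dotProduct_comm, sub_dotProduct]
      have h1 := congrFun hAb i
      have h2 := congrFun hAb i0
      simp only [mulVec, Pi.smul_apply, Pi.one_apply] at h1 h2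
      rw [h1, h2, sub_self]
  have hcomp := hind.comp
    (φ := fun t : Unit → ℝ => (1 : Fin K → ℝ) ⬝ᵥ Sig⁻¹ *ᵥ (μ • 1) + t ())
    (ψ := f) (by fun_prop) hfmeas
  have hTm : Measurable (fun z : Fin K → ℝ => (1 : Fin K → ℝ) ⬝ᵥ Sig⁻¹ *ᵥ z) := by
    have : Continuous (fun z : Fin K → ℝ => (1 : Fin K → ℝ) ⬝ᵥ Sig⁻¹ *ᵥ z) := by fun_prop
    exact this.measurable
  have hhm : Measurable (fun ξ : Fin K → ℝ => μ • (1 : Fin K → ℝ) + A *ᵥ ξ) := by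
    have : Continuous (fun ξ : Fin K → ℝ => μ • (1 : Fin K → ℝ) + A *ᵥ ξ) := by fun_prop
    exact this.measurable
  have hT : ∀ ξ : Fin K → ℝ, (1 : Fin K → ℝ) ⬝ᵥ Sig⁻¹ *ᵥ (μ • (1 : Fin K → ℝ) + A *ᵥ ξ)
      = (1 : Fin K → ℝ) ⬝ᵥ Sig⁻¹ *ᵥ (μ • 1) + b ⬝ᵥ ξ := by
    intro ξ
    rw [mulVec_add, dotProduct_add, hb, dotProduct_mulVec 1 Sig⁻¹ (A *ᵥ ξ), ← mulVec_transpose,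
      hSigT, dotProduct_mulVec _ A, ← mulVec_transpose A]
  have hF : ∀ ξ : Fin K → ℝ, f (μ • (1 : Fin K → ℝ) + A *ᵥ ξ)
      = f (fun i => (A i - A i0) ⬝ᵥ ξ) := by
    intro ξ
    rw [← hf _ (μ + (A *ᵥ ξ) i0)]
    congr 1
    ext i
    simp [mulVec, sub_dotProduct]
  have key : IndepFun (fun z : Fin K → ℝ => (1 : Fin K → ℝ) ⬝ᵥ Sig⁻¹ *ᵥ z) f (Pr.map Z) := by
    rw [hlaw, indepFun_map_iff_aux hhm hTm hfmeas]
    convert hcomp using 1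
    · ext ξ; exact hT ξ
    · ext ξ; exact hF ξ
  exact (indepFun_map_iff_aux hZmeas hTm hfmeas).1 key
end

section
/- Let K ≥ 1, σ > 0, and let L : ℝ^K → ℝ be a measurable function satisfying L(x + c1_K) = L(x) + c for all x ∈ ℝ^K and all c ∈ ℝ. Let Z ~ N(0, σ²I_K). Then for every δ ∈ ℝ, P(L(Z) = δ) = 0; that is, the law of L(Z) is atomless. -/
open MeasureTheory ProbabilityTheory Matrix Filter Topology

lemma stdGaussianPi_ac (K : ℕ) : stdGaussianPi K ≪ (volume : Measure (Fin K → ℝ)) := by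
  unfold stdGaussianPi
  rw [volume_pi]
  induction K with
  | zero => rw [Measure.pi_of_empty, Measure.pi_of_empty]
  | succ n ih =>
    have h1 := (measurePreserving_piFinSuccAbove
      (fun _ : Fin (n + 1) => gaussianReal 0 1) 0).symm
    have h2 := (measurePreserving_piFinSuccAbove
      (fun _ : Fin (n + 1) => (volume : Measure ℝ)) 0).symm
    rw [← h1.map_eq, ← h2.map_eq]
    exact ((gaussianReal_absolutelyContinuous 0 one_ne_zero).prod ih).map h1.measurable

lemma volume_level_zero {K : ℕ} (L : (Fin K → ℝ) → ℝ) (hLmeas : Measurable L) (v : Fin K → ℝ)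
    (hL : ∀ x : Fin K → ℝ, ∀ c : ℝ, L (x + c • v) = L x + c) (δ : ℝ) :
    (volume : Measure (Fin K → ℝ)) {z | L z = δ} = 0 := by
  have hc := Measure.countable_meas_level_set_pos (μ := (volume : Measure (Fin K → ℝ))) hLmeas
  by_contra hne
  have huniv : {t : ℝ | 0 < (volume : Measure (Fin K → ℝ)) {a | L a = t}} = Set.univ := by
    ext t
    simp only [Set.mem_ofPred_eq, Set.mem_univ, iff_true]
    have : {z | L z = δ} = (fun x => x + (t - δ) • v) ⁻¹' {a | L a = t} := by
      ext x
      simp only [Set.mem_ofPred_eq, Set.mem_preimage, hL]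
      constructor <;> intro h <;> linarith
    rw [this, measure_preimage_add_right] at hne
    exact pos_iff_ne_zero.mpr hne
  rw [huniv] at hc
  exact Set.not_countable_univ hc

/-- If `L` is translation-equivariant along the all-ones direction, then the
law of `L(Z)` under `Z ~ N(0, σ²I)` is atomless: `P(L(Z) = δ) = 0` for every `δ`. -/
theorem stmt14 (K : ℕ) (hK : 1 ≤ K) (σ : ℝ) (hσ : 0 < σ)
    (μZ : Measure (Fin K → ℝ))
    (hGauss : IsGaussianVec μZ 0 (σ ^ 2 • (1 : Matrix (Fin K) (Fin K) ℝ)))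
    (L : (Fin K → ℝ) → ℝ) (hLmeas : Measurable L)
    (hL : ∀ x : Fin K → ℝ, ∀ c : ℝ, L (x + c • 1) = L x + c) :
    ∀ δ : ℝ, μZ {z | L z = δ} = 0 := by
  obtain ⟨A, hA, rfl⟩ := hGauss
  intro δ
  have hAm : Measurable (fun ξ : Fin K → ℝ => 0 + A.mulVec ξ) := by
    have : Continuous (fun ξ : Fin K → ℝ => 0 + A.mulVec ξ) := by fun_prop
    exact this.measurable
  have hS : MeasurableSet {z | L z = δ} := hLmeas (measurableSet_singleton δ)
  rw [Measure.map_apply hAm hS]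
  refine stdGaussianPi_ac K ?_
  refine volume_level_zero (fun ξ => L (0 + A.mulVec ξ)) (hLmeas.comp hAm)
    ((σ ^ 2)⁻¹ • Aᵀ.mulVec 1) (fun x c => ?_) δ
  have hv : A.mulVec ((σ ^ 2)⁻¹ • Aᵀ.mulVec 1) = 1 := by
    rw [Matrix.mulVec_smul, Matrix.mulVec_mulVec, ← hA, Matrix.smul_mulVec, Matrix.one_mulVec,
      smul_smul, inv_mul_cancel₀ (by positivity), one_smul]
  rw [Matrix.mulVec_add, Matrix.mulVec_smul, hv, ← add_assoc, hL]
end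

section
/- Let K ≥ 2 and let V be the K×K matrix with V_{11} = 1, V_{1j} = V_{j1} = 1 for 2 ≤ j ≤ K, V_{jj} = 2 for 2 ≤ j ≤ K, and V_{jk} = 1 for 2 ≤ j ≠ k ≤ K. Then V is invertible with V^{-1} given by (V^{-1})_{11} = K, (V^{-1})_{1j} = (V^{-1})_{j1} = −1 for 2 ≤ j ≤ K, (V^{-1})_{jj} = 1 for 2 ≤ j ≤ K, and (V^{-1})_{jk} = 0 for 2 ≤ j ≠ k ≤ K. Moreover λ := 1_K^TV^{-1}1_K = 1, and for every y ∈ ℝ^K: 1_K^TV^{-1}y/λ = y_1, and (1/λ)·(y − y_1 1_K)^TV^{-1}(y − y_1 1_K) = Σ_{j=2}^K (y_j − y_1)². (Hence the optimal confidence interval for the cheap-bootstrap covariance structure coincides with the cheap bootstrap interval, centered at the original estimate with variance estimator Σ_{j=2}^K (y_j − y_1)².) -/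
open MeasureTheory ProbabilityTheory Matrix Filter Topology

/-- The cheap-bootstrap covariance matrix `V` (first coordinate the full-data
estimate, the rest `K−1` resample estimates) has the displayed explicit inverse, `λ = 1ᵀV⁻¹1 = 1`,
the optimal point estimator is the first coordinate, and the optimal variance estimator is
`∑_{j≥2} (yⱼ − y₁)²`. -/
theorem stmt16 (K : ℕ) (hK : 2 ≤ K) (i0 : Fin K) (hi0 : (i0 : ℕ) = 0)
    (V W : Matrix (Fin K) (Fin K) ℝ)
    (hV : V = Matrix.of fun i j =>
      if i = j then (if i = i0 then (1 : ℝ) else 2) else 1)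
    (hW : W = Matrix.of fun i j =>
      if i = i0 ∧ j = i0 then (K : ℝ)
      else if i = i0 ∨ j = i0 then -1
      else if i = j then 1 else 0) :
    V * W = 1 ∧ W * V = 1 ∧ V⁻¹ = W ∧
    (1 : Fin K → ℝ) ⬝ᵥ W.mulVec 1 = 1 ∧
    (∀ y : Fin K → ℝ,
      ((1 : Fin K → ℝ) ⬝ᵥ W.mulVec y) / ((1 : Fin K → ℝ) ⬝ᵥ W.mulVec 1) = y i0) ∧
    (∀ y : Fin K → ℝ,
      (1 / ((1 : Fin K → ℝ) ⬝ᵥ W.mulVec 1)) *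
        ((y - y i0 • 1) ⬝ᵥ W.mulVec (y - y i0 • 1)) =
      ∑ j ∈ Finset.univ.filter (fun j => j ≠ i0), (y j - y i0) ^ 2) := by
  have hWm : ∀ (y : Fin K → ℝ) (i : Fin K), W.mulVec y i =
      y i - (if i = i0 then 1 else 0) * (∑ j, y j) - y i0
        + (K + 1) * ((if i = i0 then 1 else 0) * y i0) := by
    intro y i
    have h1 : ∀ j, W i j * y j = (if i = j then y j else 0)
        - (if i = i0 then 1 else 0) * y j - (if j = i0 then y j else 0)
        + (K + 1) * ((if i = i0 then 1 else 0) * (if j = i0 then y j else 0)) := by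
      intro j
      rw [hW, Matrix.of_apply]
      by_cases hi : i = i0
      · by_cases hj : j = i0
        · subst hi; subst hj; simp; ring
        · have : i ≠ j := fun h => hj (h ▸ hi)
          simp [hi, hj, Ne.symm hj]
      · by_cases hj : j = i0
        · simp [hi, hj]
        · by_cases hij : i = j <;> simp [hi, hj, hij]
    simp only [Matrix.mulVec, dotProduct, h1, Finset.sum_add_distrib, Finset.sum_sub_distrib,
      ← Finset.mul_sum]
    simp
  have hone : ∀ y : Fin K → ℝ, (1 : Fin K → ℝ) ⬝ᵥ W.mulVec y = y i0 := by
    intro y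
    simp only [dotProduct, hWm, Pi.one_apply, one_mul, Finset.sum_add_distrib,
      Finset.sum_sub_distrib, ← Finset.mul_sum, ← Finset.sum_mul]
    simp
    ring
  have hWV : W * V = 1 := by
    ext i j
    have h2 : (W * V) i j = W.mulVec (fun k => V k j) i := rfl
    have h3 : ∀ k, V k j = 1 + (if k = j then (if j = i0 then 0 else 1) else 0) := by
      intro k
      rw [hV, Matrix.of_apply]
      by_cases hk : k = j
      · subst hk
        by_cases h : k = i0 <;> simp [h]; norm_num
      · simp [hk]
    rw [h2, hWm, Matrix.one_apply]
    simp only [h3, Finset.sum_add_distrib]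
    by_cases hi : i = i0 <;> by_cases hj : j = i0
    · simp [hi, hj]
    · simp [hi, hj, Ne.symm hj]
    · simp [hi, hj]
    · simp [hi, hj, Ne.symm hj]
  have hVW : V * W = 1 := mul_eq_one_comm.mp hWV
  refine ⟨hVW, hWV, Matrix.inv_eq_right_inv hVW, by simp [hone], ?_, ?_⟩
  · intro y
    simp [hone]
  · intro y
    rw [hone, Finset.sum_filter]
    simp only [dotProduct, hWm, Pi.one_apply, div_one, one_mul]
    refine (Finset.sum_congr rfl fun j _ => ?_)
    by_cases hj : j = i0
    · simp [hj]
    · simp [hj]; ring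
end

section
/- Let K ≥ 2, α ∈ (0,1), ψ ∈ ℝ, let Σ be a K×K positive definite matrix with λ = 1_K^TΣ^{-1}1_K, and let (Y_n)_{n≥1} be ℝ^K-valued random vectors with √n(Y_n − ψ1_K) converging in distribution to N(0, σ²Σ) for some σ > 0. Define m(y) = 1_K^TΣ^{-1}y/λ and S(y)² = (1/(λ(K−1)))·(y − m(y)1_K)^TΣ^{-1}(y − m(y)1_K), so that the interval CI_GS(Y_n) = [m(Y_n) − t_{K−1,1−α/2}S(Y_n), m(Y_n) + t_{K−1,1−α/2}S(Y_n)] has length 2t_{K−1,1−α/2}S(Y_n). Then √n times the length of CI_GS(Y_n) converges in distribution to the law of (2t_{K−1,1−α/2}·σ/√(λ(K−1)))·√Q, where Q ~ χ²_{K−1}. -/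
open MeasureTheory ProbabilityTheory Matrix Filter Topology

lemma aux_mgf_sq (t : ℝ) :
    ∫ x, Real.exp (t * x ^ 2) ∂(gaussianReal 0 1) = Real.sqrt ((1 / 2) / (1 / 2 - t)) := by
  rw [integral_gaussianReal_eq_integral_smul one_ne_zero]
  have h : ∀ x : ℝ, gaussianPDFReal 0 1 x • Real.exp (t * x ^ 2)
      = (Real.sqrt (2 * Real.pi))⁻¹ * Real.exp (-(1 / 2 - t) * x ^ 2) := by
    intro x
    simp only [gaussianPDFReal, smul_eq_mul, NNReal.coe_one, mul_one, sub_zero]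
    rw [mul_assoc, ← Real.exp_add]
    congr 2
    ring
  simp_rw [h]
  rw [integral_const_mul, integral_gaussian, ← Real.sqrt_inv, ← Real.sqrt_mul (by positivity)]
  congr 1
  have := Real.pi_pos.ne'
  field_simp

lemma aux_mgf_gamma {a : ℝ} (ha : 0 < a) (t : ℝ) :
    ∫ x, Real.exp (t * x) ∂(gammaMeasure a (1 / 2)) =
      if t < 1 / 2 then ((1 / 2) / (1 / 2 - t)) ^ a else 0 := by
  have h1 : ∫ x, Real.exp (t * x) ∂(gammaMeasure a (1 / 2)) =
      ∫ x in Set.Ioi 0, ((1 / 2) ^ a / Real.Gamma a) *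
        (x ^ (a - 1) * Real.exp (-((1 / 2 - t) * x))) := by
    rw [gammaMeasure, integral_withDensity_eq_integral_toReal_smul
      (by unfold gammaPDF; fun_prop) (by simp [gammaPDF])]
    rw [← integral_Ici_eq_integral_Ioi, ← integral_indicator measurableSet_Ici]
    congr 1
    ext x
    simp only [gammaPDF, smul_eq_mul, Set.indicator, Set.mem_Ici]
    rw [ENNReal.toReal_ofReal (gammaPDFReal_nonneg ha (by norm_num) x), gammaPDFReal]
    split_ifs
    · rw [mul_assoc, mul_assoc, ← Real.exp_add]
      congr 3
      ring
    · simp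
  rw [h1, integral_const_mul]
  have hG := Real.Gamma_pos_of_pos ha
  split_ifs with ht
  · rw [Real.integral_rpow_mul_exp_neg_mul_Ioi ha (by linarith)]
    have hp : 0 ≤ 1 / 2 - t := by linarith
    rw [Real.div_rpow one_pos.le hp, Real.div_rpow one_half_pos.le hp]
    have h2 : ((1 / 2 - t) ^ a) ≠ 0 := (Real.rpow_pos_of_pos (by linarith) a).ne'
    rw [Real.one_rpow]
    generalize (1 / 2 - t) ^ a = q at h2
    generalize ((1 : ℝ) / 2) ^ a = q'
    have := hG.ne'
    field_simp
  · rw [integral_undef, mul_zero]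
    intro hi
    refine not_integrableOn_Ioi_rpow (a - 1) ?_
    refine Integrable.mono' hi (by fun_prop) ?_
    refine (ae_restrict_iff' measurableSet_Ioi).2 (ae_of_all _ fun x hx => ?_)
    have hx : 0 < x := hx
    rw [Real.norm_eq_abs, abs_of_nonneg (by positivity)]
    refine le_mul_of_one_le_right (by positivity) (Real.one_le_exp ?_)
    nlinarith

lemma aux_chiSq (K : ℕ) (hK : 2 ≤ K) (i0 : Fin K) :
    (Measure.pi fun _ : Fin K => gaussianReal 0 1).map
      (fun x => ∑ i ∈ Finset.univ.erase i0, x i ^ 2) = chiSq ((K : ℝ) - 1) := by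
  have hK' : (2 : ℝ) ≤ K := by exact_mod_cast hK
  have ha : 0 < ((K : ℝ) - 1) / 2 := by linarith
  set X : (Fin K → ℝ) → ℝ := fun x => ∑ i ∈ Finset.univ.erase i0, x i ^ 2 with hX
  have hXm : Measurable X := by fun_prop
  set μ := Measure.pi fun _ : Fin K => gaussianReal 0 1
  have : IsProbabilityMeasure (chiSq ((K : ℝ) - 1)) :=
    isProbabilityMeasure_gammaMeasure ha (by norm_num)
  have hg : ∀ t, mgf id (chiSq ((K : ℝ) - 1)) t =
      if t < 1 / 2 then ((1 / 2) / (1 / 2 - t)) ^ (((K : ℝ) - 1) / 2) else 0 :=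
    fun t => aux_mgf_gamma ha t
  have hmgf : mgf X μ = mgf id (chiSq ((K : ℝ) - 1)) := by
    ext t
    rw [hg]
    have h1 : ∀ x : Fin K → ℝ, Real.exp (t * X x) =
        ∏ i, (fun (i : Fin K) (y : ℝ) => if i = i0 then 1 else Real.exp (t * y ^ 2)) i (x i) := by
      intro x
      rw [hX, Finset.mul_sum, Real.exp_sum, ← Finset.mul_prod_erase _ _ (Finset.mem_univ i0)]
      simp only [if_true, one_mul]
      refine Finset.prod_congr rfl fun i hi => ?_
      rw [if_neg (Finset.ne_of_mem_erase hi)]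
    unfold mgf
    rw [integral_congr_ae (ae_of_all _ h1)]
    rw [show μ = Measure.pi fun _ : Fin K => gaussianReal 0 1 from rfl,
      integral_fintype_prod_eq_prod
        (fun (i : Fin K) (y : ℝ) => if i = i0 then (1 : ℝ) else Real.exp (t * y ^ 2)), ← Finset.mul_prod_erase _ _ (Finset.mem_univ i0)]
    rw [Finset.prod_congr rfl (g := fun _ => Real.sqrt ((1 / 2) / (1 / 2 - t)))]
    · simp only [if_true, integral_const, probReal_univ, smul_eq_mul, mul_one, one_mul,
        Finset.prod_const, Finset.card_erase_of_mem (Finset.mem_univ i0), Finset.card_univ,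
        Fintype.card_fin]
      split_ifs with ht
      · rw [Real.sqrt_eq_rpow, ← Real.rpow_natCast, ← Real.rpow_mul (by
          apply div_nonneg <;> linarith), Nat.cast_sub (by omega)]
        congr 1
        push_cast
        ring
      · rw [Real.sqrt_eq_zero_of_nonpos (div_nonpos_of_nonneg_of_nonpos (by norm_num)
          (by linarith)), zero_pow (by omega)]
    · intro i hi
      simp only [if_neg (Finset.ne_of_mem_erase hi)]
      exact aux_mgf_sq t
  have h0 : (0 : ℝ) ∈ interior (integrableExpSet X μ) := by
    rw [mem_interior]
    refine ⟨Set.Iio (1 / 2), fun t ht => ?_, isOpen_Iio, by norm_num⟩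
    have ht : t < 1 / 2 := ht
    have : 0 < mgf X μ t := by
      rw [hmgf, hg, if_pos ht]
      apply Real.rpow_pos_of_pos
      apply div_pos <;> linarith
    exact mgf_pos_iff.1 this
  have hE := eqOn_complexMGF_of_mgf hmgf
  rw [← Measure.map_id (μ := chiSq ((K : ℝ) - 1))]
  have := Measure.isProbabilityMeasure_map (μ := μ) hXm.aemeasurable
  apply Measure.ext_of_charFun
  ext t
  have := hE (x := t * Complex.I) (by simpa using h0)
  rw [← complexMGF_mul_I hXm.aemeasurable, ← complexMGF_mul_I aemeasurable_id]
  exact this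

lemma aux_proj (K : ℕ) (hK : 2 ≤ K) (w : Fin K → ℝ) (hw : 0 < w ⬝ᵥ w) :
    (stdGaussianPi K).map (fun x => x ⬝ᵥ x - (w ⬝ᵥ x) ^ 2 / (w ⬝ᵥ w)) = chiSq ((K : ℝ) - 1) := by
  let i0 : Fin K := ⟨0, by omega⟩
  rw [← aux_chiSq K hK i0]
  set v : EuclideanSpace ℝ (Fin K) := WithLp.toLp 2 w with hv
  have hvn : ‖v‖ ^ 2 = w ⬝ᵥ w := by
    rw [EuclideanSpace.real_norm_sq_eq]; simp [hv, dotProduct, sq]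
  have hvp : 0 < ‖v‖ := by
    have : 0 < ‖v‖ ^ 2 := hvn ▸ hw
    exact lt_of_le_of_ne (norm_nonneg v) fun h => by rw [← h] at this; simp at this
  set u : EuclideanSpace ℝ (Fin K) := ‖v‖⁻¹ • v with hu
  have hun : ‖u‖ = 1 := by rw [hu, norm_smul]; simp [hvp.ne']
  obtain ⟨b, hb⟩ := Orthonormal.exists_orthonormalBasis_extension_of_card_eq (𝕜 := ℝ)
    (E := EuclideanSpace ℝ (Fin K)) (ι := Fin K) (by simp) (v := fun _ => u) (s := {i0})
    (by
      refine ⟨fun i => hun, fun i j hij => ?_⟩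
      exact absurd (Subsingleton.elim i j) hij)
  have hb0 : b i0 = u := hb i0 rfl
  let G : EuclideanSpace ℝ (Fin K) → ℝ := fun z => ‖z‖ ^ 2 - (inner ℝ u z) ^ 2
  have hG : Measurable G := by
    have : Continuous G := by fun_prop
    exact this.measurable
  have e1 : (fun x : Fin K → ℝ => x ⬝ᵥ x - (w ⬝ᵥ x) ^ 2 / (w ⬝ᵥ w)) = G ∘ (WithLp.toLp 2) := by
    ext x
    simp only [G, Function.comp]
    congr 1
    · rw [EuclideanSpace.real_norm_sq_eq]; simp [dotProduct, sq]
    · rw [hu, real_inner_smul_left, mul_pow, inv_pow, hvn]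
      have : inner ℝ v (WithLp.toLp 2 x) = w ⬝ᵥ x := by
        simp [hv, PiLp.inner_apply, dotProduct, mul_comm]
      rw [this]; ring
  have e2 : (fun x : Fin K → ℝ => ∑ i ∈ Finset.univ.erase i0, x i ^ 2)
      = G ∘ (fun x => ∑ i, x i • b i) := by
    ext x
    simp only [G, Function.comp]
    have r1 : inner ℝ u (∑ i, x i • b i) = x i0 := by
      rw [← hb0, b.orthonormal.inner_right_fintype]
    have r2 : ‖∑ i, x i • b i‖ ^ 2 = ∑ i, x i ^ 2 := by
      rw [← real_inner_self_eq_norm_sq, b.orthonormal.inner_sum]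
      simp [sq]
    rw [r1, r2, ← Finset.add_sum_erase _ _ (Finset.mem_univ i0)]
    ring
  rw [e1, e2, ← Measure.map_map hG (by fun_prop), ← Measure.map_map hG (by fun_prop),
    ← stdGaussian_eq_map_pi_orthonormalBasis b, stdGaussianPi, map_pi_eq_stdGaussian]

/-- The key quadratic form identity for the residual. -/
lemma aux_quad {K : ℕ} (Sig A : Matrix (Fin K) (Fin K) ℝ) (hSig : Sig.PosDef) (σ : ℝ)
    (hσ : 0 < σ) (hA : σ ^ 2 • Sig = A * Aᵀ) (hK : 2 ≤ K) :
    ∃ w : Fin K → ℝ, 0 < w ⬝ᵥ w ∧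
      (1 : Fin K → ℝ) ⬝ᵥ Sig⁻¹.mulVec 1 = σ ^ 2 * (w ⬝ᵥ w) ∧
      ∀ ξ : Fin K → ℝ, ∀ c : ℝ,
        c = ((1 : Fin K → ℝ) ⬝ᵥ Sig⁻¹.mulVec (A.mulVec ξ)) /
          ((1 : Fin K → ℝ) ⬝ᵥ Sig⁻¹.mulVec 1) →
        (A.mulVec ξ - c • 1) ⬝ᵥ Sig⁻¹.mulVec (A.mulVec ξ - c • 1) =
          σ ^ 2 * (ξ ⬝ᵥ ξ - (w ⬝ᵥ ξ) ^ 2 / (w ⬝ᵥ w)) := by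
  have hs2 : σ ^ 2 ≠ 0 := by positivity
  have hdS : IsUnit Sig.det := hSig.det_pos.ne'.isUnit
  have hdA : IsUnit A.det := by
    rw [isUnit_iff_ne_zero]
    intro h0
    have := congrArg Matrix.det hA
    rw [Matrix.det_smul, Matrix.det_mul, h0, zero_mul] at this
    exact mul_ne_zero (pow_ne_zero _ hs2) hSig.det_pos.ne' this
  have hAt : IsUnit Aᵀ.det := by rwa [Matrix.det_transpose]
  -- `Aᵀ Sig⁻¹ A = σ² I`
  have key : Aᵀ * Sig⁻¹ * A = σ ^ 2 • (1 : Matrix (Fin K) (Fin K) ℝ) := by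
    have h1 : A * (Aᵀ * Sig⁻¹ * A) = A * (σ ^ 2 • (1 : Matrix (Fin K) (Fin K) ℝ)) := by
      rw [← Matrix.mul_assoc, ← Matrix.mul_assoc, ← hA, Matrix.smul_mul,
        Matrix.mul_nonsing_inv _ hdS, Matrix.smul_mul, Matrix.one_mul, Matrix.mul_smul,
        Matrix.mul_one]
    have h2 := congrArg (fun M => A⁻¹ * M) h1
    simpa only [Matrix.nonsing_inv_mul_cancel_left _ _ hdA] using h2
  have bil : ∀ x y : Fin K → ℝ, A.mulVec x ⬝ᵥ Sig⁻¹.mulVec (A.mulVec y) = σ ^ 2 * (x ⬝ᵥ y) := by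
    intro x y
    have : A.mulVec x ⬝ᵥ Sig⁻¹.mulVec (A.mulVec y) = x ⬝ᵥ (Aᵀ * Sig⁻¹ * A).mulVec y := by
      rw [← Matrix.mulVec_mulVec, ← Matrix.mulVec_mulVec, Matrix.dotProduct_mulVec x Aᵀ,
        Matrix.vecMul_transpose]
    rw [this, key, Matrix.smul_mulVec, Matrix.one_mulVec, dotProduct_smul, smul_eq_mul]
  set w : Fin K → ℝ := A⁻¹.mulVec 1 with hw
  have hw1 : A.mulVec w = 1 := by
    rw [hw, Matrix.mulVec_mulVec, Matrix.mul_nonsing_inv _ hdA, Matrix.one_mulVec]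
  have hwne : w ≠ 0 := by
    intro h
    rw [h, Matrix.mulVec_zero] at hw1
    have := congrFun hw1 ⟨0, by omega⟩
    simp at this
  have hww : 0 < w ⬝ᵥ w := by
    have h0 : 0 ≤ w ⬝ᵥ w := Finset.sum_nonneg fun i _ => mul_self_nonneg _
    exact lt_of_le_of_ne h0 fun h => hwne (dotProduct_self_eq_zero.1 h.symm)
  refine ⟨w, hww, ?_, ?_⟩
  · rw [← hw1, bil]
  · intro ξ c hc
    rw [← hw1, bil, bil] at hc
    have hc' : c = (w ⬝ᵥ ξ) / (w ⬝ᵥ w) := by rw [hc]; field_simp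
    rw [← hw1, ← Matrix.mulVec_smul, ← Matrix.mulVec_sub, bil]
    congr 1
    simp only [sub_dotProduct, dotProduct_sub, smul_dotProduct, dotProduct_smul, smul_eq_mul]
    rw [dotProduct_comm ξ w, hc']
    field_simp
    ring

/-- Under the Gaussian limit `N(0, σ²Σ)` for `√n(Yₙ − ψ1)`, the rescaled
length `√n · 2 t_{K−1,1−α/2} S(Yₙ)` of `CI_GS` converges in distribution to the law of
`(2 t_{K−1,1−α/2} σ/√(λ(K−1))) √Q` with `Q ~ χ²_{K−1}`. -/
theorem stmt18 {Ω : Type*} [MeasurableSpace Ω] (P : Measure Ω) [IsProbabilityMeasure P]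
    (K : ℕ) (hK : 2 ≤ K) (α : ℝ) (hα : α ∈ Set.Ioo (0 : ℝ) 1) (ψ : ℝ)
    (Sig : Matrix (Fin K) (Fin K) ℝ) (hSig : Sig.PosDef)
    (lam : ℝ) (hlam : lam = (1 : Fin K → ℝ) ⬝ᵥ Sig⁻¹.mulVec 1)
    (Y : ℕ → Ω → Fin K → ℝ) (hYmeas : ∀ n, Measurable (Y n))
    (σ : ℝ) (hσ : 0 < σ) (μlim : Measure (Fin K → ℝ))
    (hGauss : IsGaussianVec μlim 0 (σ ^ 2 • Sig))
    (hCLT : TendstoInDist P (fun n ω => Real.sqrt n • (Y n ω - ψ • 1)) μlim)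
    (m : (Fin K → ℝ) → ℝ) (hm : ∀ y, m y = ((1 : Fin K → ℝ) ⬝ᵥ Sig⁻¹.mulVec y) / lam)
    (S : (Fin K → ℝ) → ℝ)
    (hS : ∀ y, S y = Real.sqrt ((1 / (lam * ((K : ℝ) - 1))) *
      ((y - m y • 1) ⬝ᵥ Sig⁻¹.mulVec (y - m y • 1)))) :
    TendstoInDist P
      (fun n ω => Real.sqrt n * (2 * tQuantile ((K : ℝ) - 1) (1 - α / 2) * S (Y n ω)))
      ((chiSq ((K : ℝ) - 1)).map (fun x =>
        (2 * tQuantile ((K : ℝ) - 1) (1 - α / 2) * σ / Real.sqrt (lam * ((K : ℝ) - 1))) *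
          Real.sqrt x)) := by
  have hK' : (2 : ℝ) ≤ K := by exact_mod_cast hK
  obtain ⟨A, hA, hμ⟩ := hGauss
  obtain ⟨w, hww, hlw, hquad⟩ := aux_quad Sig A hSig σ hσ hA hK
  rw [← hlam] at hlw hquad
  have hlp : 0 < lam := by rw [hlw]; positivity
  set T := tQuantile ((K : ℝ) - 1) (1 - α / 2)
  -- shift and scale
  have hmc : Continuous m := by
    rw [show m = _ from funext hm]
    fun_prop
  have hSc : Continuous S := by
    rw [show S = _ from funext hS]
    fun_prop
  have hscale : ∀ (s : ℝ), 0 ≤ s → ∀ y, S (s • (y - ψ • 1)) = s * S y := by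
    intro s hs y
    have hm1 : m (s • (y - ψ • 1)) = s * (m y - ψ) := by
      rw [hm, hm, Matrix.mulVec_smul, Matrix.mulVec_sub, Matrix.mulVec_smul, dotProduct_smul,
        dotProduct_sub, dotProduct_smul, ← hlam]
      simp only [smul_eq_mul]
      field_simp
    have hr : s • (y - ψ • 1) - m (s • (y - ψ • 1)) • (1 : Fin K → ℝ) = s • (y - m y • 1) := by
      rw [hm1]
      ext i
      simp
      ring
    rw [hS, hS y, hr, Matrix.mulVec_smul, dotProduct_smul, smul_dotProduct]
    simp only [smul_eq_mul]
    rw [show ∀ a b : ℝ, a * (s * (s * b)) = s ^ 2 * (a * b) from fun a b => by ring,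
      Real.sqrt_mul (sq_nonneg s), Real.sqrt_sq hs]
  intro f
  have hT : Continuous fun y => 2 * T * S y := by fun_prop
  have h := hCLT (f.compContinuous ⟨_, hT⟩)
  simp only [BoundedContinuousFunction.compContinuous_apply, ContinuousMap.coe_mk] at h
  have e1 : ∀ n : ℕ, ∀ ω, 2 * T * S (Real.sqrt n • (Y n ω - ψ • 1))
      = Real.sqrt n * (2 * T * S (Y n ω)) := by
    intro n ω
    rw [hscale _ (Real.sqrt_nonneg _)]
    ring
  simp_rw [e1] at h
  convert h using 2
  have hAm : Measurable fun ξ : Fin K → ℝ => (0 : Fin K → ℝ) + A.mulVec ξ := by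
    have : Continuous fun ξ : Fin K → ℝ => (0 : Fin K → ℝ) + A.mulVec ξ := by fun_prop
    exact this.measurable
  have hcont : Continuous fun x : ℝ => (2 * T * σ / Real.sqrt (lam * ((K : ℝ) - 1))) * Real.sqrt x := by
    fun_prop
  rw [hμ, integral_map hAm.aemeasurable
    (f := fun x => f (2 * T * S x)) (f.continuous.comp hT).aestronglyMeasurable]
  rw [integral_map hcont.measurable.aemeasurable f.continuous.aestronglyMeasurable]
  have hqc : Continuous fun x : Fin K → ℝ => x ⬝ᵥ x - (w ⬝ᵥ x) ^ 2 / (w ⬝ᵥ w) := by fun_prop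
  rw [← aux_proj K hK w hww, integral_map hqc.measurable.aemeasurable
    (f := fun x => f ((2 * T * σ / Real.sqrt (lam * ((K : ℝ) - 1))) * Real.sqrt x))
    (f.continuous.comp hcont).aestronglyMeasurable]
  congr 1
  ext ξ
  congr 1
  rw [zero_add, hS, hquad ξ _ (hm _)]
  have hd : 0 < lam * ((K : ℝ) - 1) := mul_pos hlp (by linarith)
  generalize ξ ⬝ᵥ ξ - (w ⬝ᵥ ξ) ^ 2 / w ⬝ᵥ w = q
  generalize lam * ((K : ℝ) - 1) = d at hd
  have h3 : Real.sqrt (1 / d * (σ ^ 2 * q)) = (Real.sqrt d)⁻¹ * (σ * Real.sqrt q) := by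
    rw [Real.sqrt_mul (by positivity), Real.sqrt_mul (sq_nonneg σ), Real.sqrt_sq hσ.le, one_div,
      Real.sqrt_inv]
  rw [h3]
  ring
end

section
/- Let K ≥ 2 and s > 0, and let V be the K×K matrix with V_{11} = 1, V_{1j} = V_{j1} = 1 for 2 ≤ j ≤ K, V_{jj} = 1 + s for 2 ≤ j ≤ K, and V_{jk} = 1 for 2 ≤ j ≠ k ≤ K. Then V is invertible with V^{-1} given by (V^{-1})_{11} = 1 + (K−1)/s, (V^{-1})_{1j} = (V^{-1})_{j1} = −1/s for 2 ≤ j ≤ K, (V^{-1})_{jj} = 1/s for 2 ≤ j ≤ K, and (V^{-1})_{jk} = 0 for 2 ≤ j ≠ k ≤ K. Moreover λ := 1_K^TV^{-1}1_K = 1, and for every y ∈ ℝ^K: 1_K^TV^{-1}y/λ = y_1, and (1/λ)·(y − y_1 1_K)^TV^{-1}(y − y_1 1_K) = (1/s)·Σ_{j=2}^K (y_j − y_1)². (Hence the optimal confidence interval for the weighted cheap-bootstrap covariance structure, with s = σ_W² the limiting rescaled weight variance, coincides with the weighted cheap bootstrap interval.) -/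
open MeasureTheory ProbabilityTheory Matrix Filter Topology

/-- The weighted-cheap-bootstrap covariance matrix `V` (with limiting rescaled
weight variance `s`) has the displayed explicit inverse, `λ = 1ᵀV⁻¹1 = 1`, the optimal point
estimator is the first coordinate, and the optimal variance estimator is
`(1/s)∑_{j≥2}(yⱼ − y₁)²`. -/
theorem stmt19 (K : ℕ) (hK : 2 ≤ K) (s : ℝ) (hs : 0 < s)
    (i0 : Fin K) (hi0 : (i0 : ℕ) = 0)
    (V W : Matrix (Fin K) (Fin K) ℝ)
    (hV : V = Matrix.of fun i j =>
      if i = j then (if i = i0 then (1 : ℝ) else 1 + s) else 1)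
    (hW : W = Matrix.of fun i j =>
      if i = i0 ∧ j = i0 then 1 + ((K : ℝ) - 1) / s
      else if i = i0 ∨ j = i0 then -1 / s
      else if i = j then 1 / s else 0) :
    V * W = 1 ∧ W * V = 1 ∧ V⁻¹ = W ∧
    (1 : Fin K → ℝ) ⬝ᵥ W.mulVec 1 = 1 ∧
    (∀ y : Fin K → ℝ,
      ((1 : Fin K → ℝ) ⬝ᵥ W.mulVec y) / ((1 : Fin K → ℝ) ⬝ᵥ W.mulVec 1) = y i0) ∧
    (∀ y : Fin K → ℝ,
      (1 / ((1 : Fin K → ℝ) ⬝ᵥ W.mulVec 1)) *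
        ((y - y i0 • 1) ⬝ᵥ W.mulVec (y - y i0 • 1)) =
      (1 / s) * ∑ j ∈ Finset.univ.filter (fun j => j ≠ i0), (y j - y i0) ^ 2) := by
  have hs0 : s ≠ 0 := hs.ne'
  have hW' : ∀ a b, W a b = (if a = b then 1 / s else 0) - (if a = i0 then 1 / s else 0)
      - (if b = i0 then 1 / s else 0)
      + (if a = i0 then (if b = i0 then 1 + (K : ℝ) / s else 0) else 0) := by
    intro a b
    rw [hW, Matrix.of_apply]
    by_cases ha : a = i0 <;> by_cases hb : b = i0
    · subst ha; subst hb; simp; ring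
    · subst ha; simp [hb, Ne.symm hb]; ring
    · subst hb; simp [ha]; ring
    · simp [ha, hb]
  have hV' : ∀ a b, V a b = 1 + (if a = b then s else 0)
      - (if a = i0 then (if b = i0 then s else 0) else 0) := by
    intro a b
    rw [hV, Matrix.of_apply]
    by_cases ha : a = i0 <;> by_cases hb : b = i0
    · subst ha; subst hb; simp
    · subst ha; simp [hb, Ne.symm hb]
    · subst hb; simp [ha]
    · by_cases hab : a = b <;> simp [ha, hb, hab]
  have hmv : ∀ (z : Fin K → ℝ) a, W.mulVec z a = z a / s
      - (if a = i0 then (∑ b, z b) / s else 0) - z i0 / s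
      + (if a = i0 then (1 + (K : ℝ) / s) * z i0 else 0) := by
    intro z a
    simp only [Matrix.mulVec, dotProduct, hW', add_mul, sub_mul, Finset.sum_add_distrib,
      Finset.sum_sub_distrib]
    by_cases ha : a = i0
    · simp [ha, ite_mul, ← Finset.mul_sum]; ring
    · simp [ha, ite_mul]; ring
  have hdot : ∀ z : Fin K → ℝ, (1 : Fin K → ℝ) ⬝ᵥ W.mulVec z = z i0 := by
    intro z
    simp only [dotProduct, hmv, Finset.sum_add_distrib, Finset.sum_sub_distrib,
      Pi.one_apply, one_mul]
    simp [← Finset.sum_div]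
    field_simp
    ring
  have hWV : W * V = 1 := by
    ext a b
    have h := hmv (fun c => V c b) a
    have h2 : (W * V) a b = W.mulVec (fun c => V c b) a := rfl
    rw [h2, h]
    have hsum : ∑ c, V c b = K + s - (if b = i0 then s else 0) := by
      simp [hV', Finset.sum_add_distrib, Finset.sum_sub_distrib]
    rw [hsum, hV', hV', Matrix.one_apply]
    by_cases ha : a = i0 <;> by_cases hb : b = i0
    · subst ha; subst hb; simp
    · subst ha; simp [hb, Ne.symm hb]; field_simp; ring
    · subst hb; simp [ha]
    · by_cases hab : a = b <;> simp [ha, hb, hab, Ne.symm hb] <;> field_simp <;> ring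
  have hVW : V * W = 1 := mul_eq_one_comm.mp hWV
  refine ⟨hVW, hWV, Matrix.inv_eq_right_inv hVW, ?_, ?_, ?_⟩
  · rw [hdot]; rfl
  · intro y; rw [hdot, hdot]; simp
  · intro y
    rw [hdot]
    have h0 : (y - y i0 • (1 : Fin K → ℝ)) i0 = 0 := by simp
    have hq : ∀ z : Fin K → ℝ, z i0 = 0 → z ⬝ᵥ W.mulVec z = (1 / s) * ∑ j, z j ^ 2 := by
      intro z hz
      rw [dotProduct, Finset.mul_sum]
      refine Finset.sum_congr rfl fun j _ => ?_
      rw [hmv, hz]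
      by_cases hj : j = i0
      · simp [hj, hz]
      · simp [hj]; ring
    rw [hq _ h0, Finset.sum_filter]
    simp only [Pi.one_apply, div_one, one_mul]
    congr 1
    refine Finset.sum_congr rfl fun j _ => ?_
    by_cases hj : j = i0 <;> simp [hj]
end
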